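/- arXiv:1804.00439 — 2 statements merged into one kernel-verified Lean document; each statement's English description precedes it below -/
import Mathlib

section
/- Assume (H₀), (Hᴵᴵ₁), (Hᴵᴵ₂), and that (Hᴵᴵ₄) holds for at least one ν. Let ν* := inf{ν ∈ (−∞, g₀) : (Hᴵᴵ₄) holds for ν}. Then there exists s₀ ∈ (ν*, +∞) such that: for ν* < s < s₀, equation (E_s) has at least one T-periodic solution, and for s > s₀, equation (E_s) has no T-periodic solutions. Moreover, if (Hᴵᴵ₃) holds for at least one ν, let ν** := inf{ν ∈ [ν*, g₀) : (Hᴵᴵ₃) holds for ν}; then for s = s₀ equation (E_s) has at least one T-periodic solution, and for ν** < s < s₀ equation (E_s) has at least two T-periodic solutions. -/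
open MeasureTheory Set Filter

noncomputable section

/-- The Lebesgue measure restricted to the interval `[0,T]`. -/
def muT (T : ℝ) : Measure ℝ := volume.restrict (Icc 0 T)

/-- `u` is a `C¹` function on `[0,T]` with derivative `u'` there, satisfying the
`T`-periodic boundary conditions `u 0 = u T` and `u' 0 = u' T`. -/
def IsC1Periodic (T : ℝ) (u u' : ℝ → ℝ) : Prop :=
  (∀ t ∈ Icc (0:ℝ) T, HasDerivWithinAt u (u' t) (Icc (0:ℝ) T) t) ∧
    ContinuousOn u' (Icc (0:ℝ) T) ∧ u 0 = u T ∧ u' 0 = u' T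

/-- `φ ∘ u'` is absolutely continuous on `[0,T]`, being the indefinite integral of the
integrable function `w` (which is then its a.e. derivative). -/
def IsACPhiDeriv (T : ℝ) (φ : ℝ → ℝ) (u' w : ℝ → ℝ) : Prop :=
  IntegrableOn w (Icc (0:ℝ) T) ∧
    ∀ t ∈ Icc (0:ℝ) T, φ (u' t) = φ (u' 0) + ∫ τ in (0:ℝ)..t, w τ

/-- `h : [0,T] × ℝ → ℝ` is a Carathéodory function: measurable in `t`, continuous in `u`
for a.e. `t`, and locally `L¹`-dominated. -/
def Caratheodory (T : ℝ) (h : ℝ → ℝ → ℝ) : Prop :=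
  (∀ u : ℝ, Measurable fun t => h t u) ∧
    (∀ᵐ t ∂(muT T), Continuous fun u => h t u) ∧
    ∀ r : ℝ, 0 < r → ∃ γ : ℝ → ℝ, IntegrableOn γ (Icc (0:ℝ) T) ∧
      ∀ᵐ t ∂(muT T), ∀ u : ℝ, |u| ≤ r → |h t u| ≤ γ t

/-- `u` is a `T`-periodic solution of `(φ(u'))' + f(u)u' + h(t,u) = 0`. -/
def IsSolE (T : ℝ) (φ f : ℝ → ℝ) (h : ℝ → ℝ → ℝ) (u : ℝ → ℝ) : Prop :=
  ∃ u' w : ℝ → ℝ, IsC1Periodic T u u' ∧ IsACPhiDeriv T φ u' w ∧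
    ∀ᵐ t ∂(muT T), w t + f (u t) * u' t + h t (u t) = 0

/-- Condition `(A₀)`: local uniform control of `h(t,u) − h(t,u₀)` for a.e. `t`. -/
def CondA0 (T : ℝ) (h : ℝ → ℝ → ℝ) : Prop :=
  ∀ t₀ ∈ Icc (0:ℝ) T, ∀ u₀ : ℝ, ∀ ε : ℝ, 0 < ε → ∃ δ : ℝ, 0 < δ ∧
    ∀ᵐ t ∂(muT T), |t - t₀| < δ → ∀ u : ℝ, |u - u₀| < δ → |h t u - h t u₀| < ε

/-- `u` is a `T`-periodic solution of `(φ(u'))' + f(u)u' + g(t,u) = s`. -/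
def IsSolEs (T : ℝ) (φ f : ℝ → ℝ) (g : ℝ → ℝ → ℝ) (s : ℝ) (u : ℝ → ℝ) : Prop :=
  ∃ u' w : ℝ → ℝ, IsC1Periodic T u u' ∧ IsACPhiDeriv T φ u' w ∧
    ∀ᵐ t ∂(muT T), w t + f (u t) * u' t + g t (u t) = s

/-- Condition `(Hᴵᴵ₃)` for `ν`: `ν < min{0,g₀}` and the mean of `g(t,u(t))` is below `ν`
for every `u ∈ C¹_T` with `u ≤ −d`. -/
def HII3 (T : ℝ) (g : ℝ → ℝ → ℝ) (g₀ ν : ℝ) : Prop :=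
  ν < min 0 g₀ ∧ ∃ d : ℝ, 0 < d ∧ ∀ u u' : ℝ → ℝ, IsC1Periodic T u u' →
    (∀ t ∈ Icc (0:ℝ) T, u t ≤ -d) → (1 / T) * (∫ t in Icc (0:ℝ) T, g t (u t)) < ν

/-- Condition `(Hᴵᴵ₄)` for `ν`: `ν < min{0,g₀}` and the mean of `g(t,u(t))` is below `ν`
for every `u ∈ C¹_T` with `u ≥ d`. -/
def HII4 (T : ℝ) (g : ℝ → ℝ → ℝ) (g₀ ν : ℝ) : Prop :=
  ν < min 0 g₀ ∧ ∃ d : ℝ, 0 < d ∧ ∀ u u' : ℝ → ℝ, IsC1Periodic T u u' →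
    (∀ t ∈ Icc (0:ℝ) T, d ≤ u t) → (1 / T) * (∫ t in Icc (0:ℝ) T, g t (u t)) < ν

/-- `ν* = inf{ν ∈ (−∞,g₀) : (Hᴵᴵ₄) holds for ν}`, as an extended real number. -/
def nuStar (T : ℝ) (g : ℝ → ℝ → ℝ) (g₀ : ℝ) : EReal :=
  sInf {x : EReal | ∃ ν : ℝ, x = (ν : EReal) ∧ HII4 T g g₀ ν}

/-- `ν** = inf{ν ∈ [ν*,g₀) : (Hᴵᴵ₃) holds for ν}`, as an extended real number. -/
def nuStarStar (T : ℝ) (g : ℝ → ℝ → ℝ) (g₀ : ℝ) : EReal :=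
  sInf {x : EReal | ∃ ν : ℝ, x = (ν : EReal) ∧ HII3 T g g₀ ν ∧
    nuStar T g g₀ ≤ (ν : EReal)}

section Brouwer

variable {E : Type*} [NormedAddCommGroup E] [InnerProductSpace ℝ E] [FiniteDimensional ℝ E]

/-- Degree-`dim E` Lagrange interpolation of `t ↦ det (1 + t A)`. -/
lemma exists_det_interpolation {ε : ℝ} (hε : 0 < ε) :
    ∃ (τ L : Fin (Module.finrank ℝ E + 1) → ℝ), (∀ i, 0 ≤ τ i ∧ τ i < ε) ∧
      ∀ A : E →L[ℝ] E, (1 + A).det = ∑ i, L i * (1 + τ i • A).det := by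
  classical
  set n := Module.finrank ℝ E
  let τ : Fin (n + 1) → ℝ := fun i => ε * ((i : ℝ) / (n + 1))
  have hinj : Function.Injective τ := by
    intro i j hij
    have h1 : (i : ℝ) / ((n : ℝ) + 1) = (j : ℝ) / (n + 1) := mul_left_cancel₀ hε.ne' hij
    have h2 : (i : ℝ) = (j : ℝ) := by
      field_simp at h1
      exact h1
    exact Fin.ext (by exact_mod_cast h2)
  refine ⟨τ, fun i => (Lagrange.basis Finset.univ τ i).eval 1, fun i => ⟨by positivity, ?_⟩, ?_⟩
  · have h1 : (i : ℝ) < n + 1 := by exact_mod_cast i.2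
    have h2 : (i : ℝ) / (n + 1) < 1 := by
      rw [div_lt_one (by positivity)]; exact h1
    calc τ i = ε * ((i : ℝ) / (n + 1)) := rfl
      _ < ε * 1 := mul_lt_mul_of_pos_left h2 hε
      _ = ε := mul_one _
  · intro A
    let b := Module.finBasis ℝ E
    let M := LinearMap.toMatrix b b (A : E →ₗ[ℝ] E)
    let P : Polynomial ℝ :=
      ((Polynomial.X : Polynomial ℝ) • M.map Polynomial.C +
        (1 : Matrix (Fin n) (Fin n) ℝ).map Polynomial.C).det
    have hP : ∀ t : ℝ, P.eval t = (1 + t • A).det := by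
      intro t
      have h1 : ((1 + t • A : E →L[ℝ] E)).det = (1 + t • M).det := by
        rw [ContinuousLinearMap.det, ← LinearMap.det_toMatrix b]
        congr 1
        ext i j
        simp [M, LinearMap.toMatrix_apply, Matrix.one_apply, Finsupp.single_apply, eq_comm]
      rw [h1]
      rw [← Polynomial.coe_evalRingHom, RingHom.map_det]
      congr 1
      ext i j
      by_cases hij : i = j <;>
        simp [hij, add_comm] <;> ring
    have hdeg : P.degree < (Finset.univ : Finset (Fin (n + 1))).card := by
      refine lt_of_le_of_lt Polynomial.degree_le_natDegree ?_
      have := Polynomial.natDegree_det_X_add_C_le M (1 : Matrix (Fin n) (Fin n) ℝ)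
      simp only [Finset.card_univ, Fintype.card_fin] at this ⊢
      exact_mod_cast Nat.lt_succ_of_le this
    have := Lagrange.eq_interpolate_of_eval_eq (s := Finset.univ) (v := τ)
      (fun i => (1 + τ i • A).det) hinj.injOn hdeg (fun i _ => hP (τ i))
    have h1 := hP 1
    rw [one_smul] at h1
    rw [← h1, this, Lagrange.interpolate_apply, Polynomial.eval_finsetSum]
    simp [mul_comm]

lemma det_one_add_pos {A : E →L[ℝ] E} (hA : ‖A‖ < 1) : 0 < (1 + A).det := by
  have hne : ∀ t ∈ Icc (0:ℝ) 1, (1 + t • A).det ≠ 0 := by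
    intro t ht h
    have h1 : ‖-(t • A)‖ < 1 := by
      rw [norm_neg, norm_smul, Real.norm_of_nonneg ht.1]
      nlinarith [norm_nonneg A, ht.2]
    have h2 := isUnit_one_sub_of_norm_lt_one h1
    rw [sub_neg_eq_add] at h2
    have h3 := h2.map (ContinuousLinearMap.toLinearMapRingHom (R₁ := ℝ) (M₁ := E))
    have h4 := h3.map (LinearMap.det : (E →ₗ[ℝ] E) →* ℝ)
    exact h4.ne_zero h
  by_contra! hcon
  have hcont : ContinuousOn (fun t : ℝ => (1 + t • A).det) (Icc 0 1) := by
    refine (ContinuousLinearMap.continuous_det.comp ?_).continuousOn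
    fun_prop
  have h0 : (1 + (0:ℝ) • A).det = 1 := by simp [ContinuousLinearMap.det]
  have := intermediate_value_Icc' (zero_le_one) hcont
  obtain ⟨t, ht, h⟩ := this (show (0:ℝ) ∈ Icc _ _ from
    ⟨by simpa using hcon, by rw [h0]; exact zero_le_one⟩)
  exact hne t ht h

end Brouwer

section Brouwer

variable {E : Type*} [NormedAddCommGroup E] [InnerProductSpace ℝ E]

/-- Extending by zero a function which is Lipschitz on the unit ball and vanishes on the unit
sphere keeps the Lipschitz constant. -/
lemma lipschitzWith_indicator_closedBall {g : E → E} {K : NNReal}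
    (hg : LipschitzOnWith K g (Metric.closedBall 0 1)) (h0 : ∀ x : E, ‖x‖ = 1 → g x = 0) :
    LipschitzWith K ((Metric.closedBall (0:E) 1).indicator g) := by
  have key : ∀ x y : E, ‖x‖ ≤ 1 → 1 < ‖y‖ → ‖g x‖ ≤ K * ‖x - y‖ := by
    intro x y hx hy
    have hc : ContinuousOn (fun t : ℝ => ‖x + t • (y - x)‖) (Icc 0 1) := by fun_prop
    obtain ⟨t, ht, h⟩ := intermediate_value_Icc zero_le_one hc
      (show (1:ℝ) ∈ Icc _ _ from ⟨by simpa using hx, by simpa using hy.le⟩)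
    have h1 := hg.norm_sub_le (x := x) (y := x + t • (y - x)) (by simpa using hx)
      (by simpa using h.le)
    rw [h0 _ h, sub_zero] at h1
    refine h1.trans ?_
    gcongr
    have : x - (x + t • (y - x)) = t • (x - y) := by module
    rw [this, norm_smul, Real.norm_of_nonneg ht.1]
    exact mul_le_of_le_one_left (norm_nonneg _) ht.2
  refine LipschitzWith.of_dist_le_mul fun x y => ?_
  rw [dist_eq_norm, dist_eq_norm]
  by_cases hx : ‖x‖ ≤ 1 <;> by_cases hy : ‖y‖ ≤ 1
  · rw [indicator_of_mem (by simpa using hx), indicator_of_mem (by simpa using hy)]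
    exact hg.norm_sub_le (by simpa using hx) (by simpa using hy)
  · rw [indicator_of_mem (by simpa using hx), indicator_of_notMem (by simpa using hy), sub_zero]
    exact key x y hx (not_le.1 hy)
  · rw [indicator_of_notMem (by simpa using hx), indicator_of_mem (by simpa using hy), zero_sub,
      norm_neg, norm_sub_rev]
    exact key y x hy (not_le.1 hx)
  · rw [indicator_of_notMem (by simpa using hx), indicator_of_notMem (by simpa using hy)]
    simp; positivity

variable [FiniteDimensional ℝ E]

/-- A perturbation of the identity by a contraction is bijective. -/
lemma bijective_id_add_of_lipschitzWith {h : E → E} {K : NNReal} (hh : LipschitzWith K h)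
    (hK : K < 1) : Function.Bijective (fun x => x + h x) := by
  constructor
  · intro x y hxy
    have h1 : x - y = h y - h x := by
      have : x + h x = y + h y := hxy
      rw [sub_eq_sub_iff_add_eq_add, this, add_comm]
    have h2 := hh.norm_sub_le y x
    rw [← h1, norm_sub_rev y x] at h2
    have h3 : (K : ℝ) < 1 := hK
    have h4 : ‖x - y‖ = 0 := by nlinarith [norm_nonneg (x - y)]
    exact sub_eq_zero.1 (norm_eq_zero.1 h4)
  · intro y
    have hc : ContractingWith K (fun x => y - h x) := by
      refine ⟨hK, LipschitzWith.of_dist_le_mul fun a b => ?_⟩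
      rw [dist_sub_left]
      exact hh.dist_le_mul a b
    refine ⟨hc.fixedPoint, ?_⟩
    have := hc.fixedPoint_isFixedPt
    have h2 : y - h hc.fixedPoint = hc.fixedPoint := this
    show hc.fixedPoint + h hc.fixedPoint = y
    nth_rewrite 1 [← h2]
    abel

variable [MeasurableSpace E] [BorelSpace E]

/-- If `g` is `C¹` on the unit ball and vanishes on the sphere, then the integral of the Jacobian
of `id + g` over the ball is the volume of the ball. -/
lemma integral_det_one_add_fderiv {g : E → E}
    (hg : ∀ x ∈ Metric.closedBall (0:E) 1, ContDiffAt ℝ 1 g x)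
    (h0 : ∀ x : E, ‖x‖ = 1 → g x = 0) (μ : Measure E) [μ.IsAddHaarMeasure] :
    ∫ x in Metric.ball (0:E) 1, (1 + fderiv ℝ g x).det ∂μ = μ.real (Metric.ball (0:E) 1) := by
  obtain ⟨K, hK⟩ := ContDiffOn.exists_lipschitzOnWith (n := 1)
    (fun x hx => (hg x hx).contDiffWithinAt) one_ne_zero (convex_closedBall (0:E) 1)
    (isCompact_closedBall (0:E) 1)
  have hKg := lipschitzWith_indicator_closedBall hK h0
  have hfd : ContinuousOn (fderiv ℝ g) (Metric.closedBall (0:E) 1) := fun x hx =>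
    ((hg x hx).continuousAt_fderiv (by simp)).continuousWithinAt
  have hintg : ∀ t : ℝ,
      IntegrableOn (fun x => (1 + t • fderiv ℝ g x).det) (Metric.ball (0:E) 1) μ := by
    intro t
    refine IntegrableOn.mono_set ?_ Metric.ball_subset_closedBall
    refine ContinuousOn.integrableOn_compact (isCompact_closedBall _ _) ?_
    refine ContinuousLinearMap.continuous_det.comp_continuousOn ?_
    fun_prop
  have hnorm : ∀ x ∈ Metric.ball (0:E) 1, ‖fderiv ℝ g x‖ ≤ K := by
    intro x hx
    exact norm_fderiv_le_of_lipschitzOn ℝ (mem_of_superset (Metric.isOpen_ball.mem_nhds hx)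
      Metric.ball_subset_closedBall) hK
  have small : ∀ t : ℝ, 0 ≤ t → t < 1 / (K + 1) →
      ∫ x in Metric.ball (0:E) 1, (1 + t • fderiv ℝ g x).det ∂μ
        = μ.real (Metric.ball (0:E) 1) := by
    intro t ht0 ht1
    have htK : t * K < 1 := by
      rw [lt_div_iff₀ (by positivity)] at ht1
      nlinarith
    lift t to NNReal using ht0
    set h : E → E := fun x => t • (Metric.closedBall (0:E) 1).indicator g x with hh
    have hlip : LipschitzWith (t * K) h := by
      refine LipschitzWith.of_dist_le_mul fun x y => ?_
      have := hKg.dist_le_mul x y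
      simp only [hh, NNReal.smul_def, dist_smul₀, NNReal.coe_mul, Real.norm_of_nonneg t.coe_nonneg]
      rw [mul_assoc]
      gcongr
    have hbij := bijective_id_add_of_lipschitzWith hlip (by exact_mod_cast htK)
    set F : E → E := fun x => x + h x with hF
    have hout : ∀ x ∉ Metric.ball (0:E) 1, F x = x := by
      intro x hx
      have h1 : 1 ≤ ‖x‖ := by simpa using hx
      have h2 : (Metric.closedBall (0:E) 1).indicator g x = 0 := by
        rcases h1.eq_or_lt with h | h
        · rw [indicator_of_mem (by simp [← h]), h0 x h.symm]
        · exact indicator_of_notMem (by simpa using h) _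
      simp [hF, hh, h2]
    have himg : F '' Metric.ball (0:E) 1 = Metric.ball (0:E) 1 := by
      ext y
      constructor
      · rintro ⟨x, hx, rfl⟩
        by_contra hy
        have : F (F x) = F x := hout _ hy
        exact hy (by rw [hbij.1 this]; exact hx)
      · intro hy
        obtain ⟨x, rfl⟩ := hbij.2 y
        refine ⟨x, ?_, rfl⟩
        by_contra hx
        exact hx (by rw [← hout x hx]; exact hy)
    have hder : ∀ x ∈ Metric.ball (0:E) 1,
        HasFDerivWithinAt F (1 + (t : ℝ) • fderiv ℝ g x) (Metric.ball (0:E) 1) x := by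
      intro x hx
      have h1 : HasFDerivAt g (fderiv ℝ g x) x :=
        ((hg x (Metric.ball_subset_closedBall hx)).differentiableAt one_ne_zero).hasFDerivAt
      have h2 : HasFDerivAt (fun x => x + (t : ℝ) • g x) (1 + (t : ℝ) • fderiv ℝ g x) x :=
        (hasFDerivAt_id x).add (h1.const_smul (t : ℝ))
      refine h2.hasFDerivWithinAt.congr (fun y hy => ?_) ?_
      · simp only [hF, hh, indicator_of_mem (Metric.ball_subset_closedBall hy)]; rfl
      · simp only [hF, hh, indicator_of_mem (Metric.ball_subset_closedBall hx)]; rfl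
    have hcv := lintegral_abs_det_fderiv_eq_addHaar_image μ measurableSet_ball hder hbij.1.injOn
    rw [himg] at hcv
    have hpos : ∀ x ∈ Metric.ball (0:E) 1, 0 < (1 + (t : ℝ) • fderiv ℝ g x).det := by
      intro x hx
      apply det_one_add_pos
      rw [norm_smul, Real.norm_of_nonneg t.coe_nonneg]
      exact lt_of_le_of_lt (mul_le_mul_of_nonneg_left (hnorm x hx) t.coe_nonneg) htK
    rw [integral_eq_lintegral_of_nonneg_ae _ (hintg t).aestronglyMeasurable, Measure.real, ← hcv]
    · congr 1
      refine setLIntegral_congr_fun measurableSet_ball fun x hx => ?_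
      simp only [abs_of_pos (hpos x hx)]
    · exact (ae_restrict_iff' measurableSet_ball).2 (ae_of_all _ fun x hx => (hpos x hx).le)
  obtain ⟨τ, L, hτ, hdet⟩ := exists_det_interpolation (E := E) (ε := 1 / (K + 1)) (by positivity)
  have hsum : ∑ i, L i = 1 := by
    have := hdet 0
    simpa [ContinuousLinearMap.det] using this.symm
  rw [show (fun x => (1 + fderiv ℝ g x).det) =
      fun x => ∑ i, L i * (1 + τ i • fderiv ℝ g x).det from funext fun x => hdet _,
    integral_finsetSum _ fun i _ => (hintg (τ i)).const_mul (L i)]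
  simp_rw [integral_const_mul, small _ (hτ _).1 (hτ _).2, ← Finset.sum_mul, hsum, one_mul]

end Brouwer

section Brouwer

variable {E : Type*} [NormedAddCommGroup E] [InnerProductSpace ℝ E] [FiniteDimensional ℝ E]

open scoped InnerProductSpace in
/-- Brouwer's theorem for `C¹` maps into the open unit ball. -/
lemma exists_fixedPoint_of_contDiff {p : E → E} (hp : ContDiff ℝ 1 p) (hp1 : ∀ x, ‖p x‖ < 1) :
    ∃ x, p x = x := by
  by_contra! hne
  let _ : MeasurableSpace E := borel E
  have _ : BorelSpace E := ⟨rfl⟩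
  set e : E → E := fun x => x - p x with he
  have he0 : ∀ x, e x ≠ 0 := fun x h => hne x (sub_eq_zero.1 h).symm
  have hea : ∀ x, 0 < ‖e x‖ ^ 2 := fun x => by have := norm_pos_iff.2 (he0 x); positivity
  set D : E → ℝ := fun x => ⟪x, e x⟫_ℝ ^ 2 + ‖e x‖ ^ 2 * (1 - ‖x‖ ^ 2) with hD
  set τ : E → ℝ := fun x => (-⟪x, e x⟫_ℝ + √(D x)) / ‖e x‖ ^ 2 with hτ
  set g : E → E := fun x => τ x • e x with hg
  have hb : ∀ x, ‖x‖ = 1 → 0 < ⟪x, e x⟫_ℝ := by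
    intro x hx
    have h1 : ⟪x, p x⟫_ℝ ≤ ‖x‖ * ‖p x‖ := real_inner_le_norm _ _
    rw [he, inner_sub_right, real_inner_self_eq_norm_sq, hx]
    rw [hx] at h1
    nlinarith [hp1 x]
  have hDpos : ∀ x ∈ Metric.closedBall (0:E) 1, 0 < D x := by
    intro x hx
    have hx1 : ‖x‖ ≤ 1 := by simpa using hx
    rcases hx1.eq_or_lt with h | h
    · have := hb x h
      simp only [hD, h]
      nlinarith
    · have h2 : 0 < 1 - ‖x‖ ^ 2 := by nlinarith [norm_nonneg x]
      have := mul_pos (hea x) h2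
      simp only [hD]
      positivity
  have heC : ContDiff ℝ 1 e := contDiff_id.sub hp
  have hgC : ∀ x ∈ Metric.closedBall (0:E) 1, ContDiffAt ℝ 1 g x := by
    intro x hx
    have hDC : ContDiff ℝ 1 D :=
      ((contDiff_id.inner ℝ heC).pow 2).add ((heC.norm_sq ℝ).mul
        (contDiff_const.sub (contDiff_id.norm_sq ℝ)))
    refine ContDiffAt.smul ?_ heC.contDiffAt
    refine ContDiffAt.div ?_ (heC.norm_sq ℝ).contDiffAt (hea x).ne'
    exact (contDiff_id.inner ℝ heC).contDiffAt.neg.add (hDC.contDiffAt.sqrt (hDpos x hx).ne')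
  have hg0 : ∀ x : E, ‖x‖ = 1 → g x = 0 := by
    intro x hx
    have h1 : D x = ⟪x, e x⟫_ℝ ^ 2 := by simp [hD, hx]
    simp [hg, hτ, h1, Real.sqrt_sq (hb x hx).le]
  have hr : ∀ x ∈ Metric.closedBall (0:E) 1, ‖x + g x‖ ^ 2 = 1 := by
    intro x hx
    have hs := Real.sq_sqrt (hDpos x hx).le
    have ht : τ x * ‖e x‖ ^ 2 = -⟪x, e x⟫_ℝ + √(D x) := by
      exact div_mul_cancel₀ _ (hea x).ne'
    rw [norm_add_sq_real, hg, inner_smul_right, norm_smul, mul_pow, Real.norm_eq_abs, sq_abs]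
    have h3 : (τ x * ‖e x‖ ^ 2 + ⟪x, e x⟫_ℝ) ^ 2 = D x := by
      rw [ht, neg_add_cancel_comm, hs]
    have h4 : ‖e x‖ ^ 2 * (‖x‖ ^ 2 + 2 * (τ x * ⟪x, e x⟫_ℝ) + τ x ^ 2 * ‖e x‖ ^ 2)
        = ‖e x‖ ^ 2 * 1 := by
      simp only [hD] at h3
      linarith
    exact mul_left_cancel₀ (hea x).ne' h4
  have hdet : ∀ x ∈ Metric.ball (0:E) 1, (1 + fderiv ℝ g x).det = 0 := by
    intro x hx
    have hx' := Metric.ball_subset_closedBall hx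
    have h1 : HasFDerivAt (fun y => y + g y) (1 + fderiv ℝ g x) x :=
      (hasFDerivAt_id x).add ((hgC x hx').differentiableAt one_ne_zero).hasFDerivAt
    have h2 := h1.norm_sq
    have h3 : (fun y => ‖y + g y‖ ^ 2) =ᶠ[nhds x] fun _ => (1:ℝ) := by
      filter_upwards [Metric.isOpen_ball.mem_nhds hx] with y hy
      exact hr y (Metric.ball_subset_closedBall hy)
    have h4 := h2.unique ((hasFDerivAt_const (1:ℝ) x).congr_of_eventuallyEq h3)
    by_contra hcon
    have h5 : IsUnit (LinearMap.det ((1 + fderiv ℝ g x : E →L[ℝ] E) : E →ₗ[ℝ] E)) :=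
      isUnit_iff_ne_zero.2 hcon
    have h6 := (LinearMap.equivOfIsUnitDet h5).surjective (x + g x)
    obtain ⟨v, hv⟩ := h6
    have h7 := congrArg (fun A : E →L[ℝ] ℝ => A v) h4
    have hv' : (1 + fderiv ℝ g x) v = x + g x := by
      simpa using hv
    have h8 : 2 * ⟪x + g x, (1 + fderiv ℝ g x) v⟫_ℝ = 0 := by
      simpa [inner_add_left, inner_add_right, mul_add] using h7
    rw [hv', real_inner_self_eq_norm_sq, hr x hx'] at h8
    norm_num at h8
  have hfin := integral_det_one_add_fderiv hgC hg0 (volume : Measure E)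
  rw [setIntegral_congr_fun measurableSet_ball hdet] at hfin
  simp only [integral_zero] at hfin
  have hpos : 0 < (volume : Measure E).real (Metric.ball (0:E) 1) :=
    ENNReal.toReal_pos (Metric.measure_ball_pos _ _ one_pos).ne' measure_ball_lt_top.ne
  linarith

/-- Brouwer's fixed point theorem, for a continuous self-map of a Euclidean space with bounded
range. -/
theorem exists_fixedPoint_of_bounded {p : E → E} (hp : Continuous p) {R : ℝ}
    (hR : ∀ x, ‖p x‖ ≤ R) : ∃ x, p x = x := by
  have hR0 : 0 ≤ R := (norm_nonneg _).trans (hR 0)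
  have happrox : ∀ ε : ℝ, 0 < ε → ε < 1 → ∃ x : E, ‖x‖ ≤ R + 1 ∧ ‖p x - x‖ ≤ ε := by
    intro ε hε hε1
    obtain ⟨q, hq, hqp, -⟩ := hp.exists_contDiff_approx 1 (ε := fun _ => ε) continuous_const
      (fun _ => hε)
    have hqR : ∀ x, ‖q x‖ < R + 1 := by
      intro x
      have h1 := hqp x
      rw [dist_eq_norm] at h1
      have h2 := norm_le_norm_add_norm_sub' (q x) (p x)
      linarith [hR x]
    have hRp : 0 < R + 1 := by linarith
    obtain ⟨x, hx⟩ := exists_fixedPoint_of_contDiff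
      (p := fun x => (R + 1)⁻¹ • q ((R + 1) • x))
      (contDiff_const.smul (hq.comp (contDiff_const.smul contDiff_id))) (by
        intro x
        rw [norm_smul, Real.norm_of_nonneg (by positivity), inv_mul_lt_iff₀ hRp, mul_one]
        exact hqR _)
    have hx2 : q ((R + 1) • x) = (R + 1) • x := by
      nth_rewrite 2 [← hx]
      rw [smul_inv_smul₀ hRp.ne']
    refine ⟨(R + 1) • x, ?_, ?_⟩
    · rw [← hx2]; exact (hqR _).le
    · have := hqp ((R + 1) • x)
      rw [hx2, dist_comm, dist_eq_norm] at this
      exact this.le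
  have hc : Continuous fun x => ‖p x - x‖ := (hp.sub continuous_id).norm
  obtain ⟨x, hx, hmin⟩ := (isCompact_closedBall (0:E) (R + 1)).exists_isMinOn
    ⟨0, by simp; linarith⟩ hc.continuousOn
  refine ⟨x, ?_⟩
  rw [← sub_eq_zero, ← norm_eq_zero]
  by_contra hne
  have hpos : 0 < ‖p x - x‖ := lt_of_le_of_ne (norm_nonneg _) (Ne.symm hne)
  obtain ⟨y, hy, hy2⟩ := happrox (min (‖p x - x‖ / 2) (1 / 2)) (by positivity)
    (lt_of_le_of_lt (min_le_right _ _) (by norm_num))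
  have h3 : ‖p x - x‖ ≤ ‖p y - y‖ := hmin (by simpa using hy)
  have h4 := min_le_left (‖p x - x‖ / 2) (1 / 2)
  linarith

end Brouwer

/-- Schauder's fixed point theorem, for a continuous self-map of a normed space whose range lies
in a compact set. -/
theorem exists_fixedPoint_of_range_subset_compact {X : Type*} [NormedAddCommGroup X]
    [NormedSpace ℝ X] {G : X → X} (hG : Continuous G) {K : Set X} (hK : IsCompact K)
    (hGK : ∀ x, G x ∈ K) : ∃ x, G x = x := by
  have happrox : ∀ ε : ℝ, 0 < ε → ∃ x, ‖x - G x‖ ≤ ε := by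
    intro ε hε
    obtain ⟨t, -, htf, htc⟩ := hK.finite_cover_balls hε
    lift t to Finset X using htf
    let wt : X → X → ℝ := fun a y => max (ε - ‖y - a‖) 0
    have hw0 : ∀ a y, 0 ≤ wt a y := fun a y => le_max_right _ _
    have hwc : ∀ a, Continuous (wt a) := fun a => by fun_prop
    have hsum : ∀ y ∈ K, 0 < ∑ a : t, wt a y := by
      intro y hy
      obtain ⟨a, ha, hya⟩ := mem_iUnion₂.1 (htc hy)
      refine Finset.sum_pos' (fun b _ => hw0 _ _) ⟨⟨a, ha⟩, Finset.mem_univ _, ?_⟩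
      rw [Metric.mem_ball, dist_eq_norm] at hya
      exact lt_max_of_lt_left (by simpa using hya)
    let S : EuclideanSpace ℝ t → X := fun l => ∑ a : t, l a • (a : X)
    have hS : Continuous S := by fun_prop
    let Φ : EuclideanSpace ℝ t → EuclideanSpace ℝ t := fun l =>
      WithLp.toLp 2 fun a : t => wt a (G (S l)) / ∑ b : t, wt b (G (S l))
    have hΦ : Continuous Φ := by
      refine (PiLp.continuous_toLp 2 _).comp (continuous_pi fun a => ?_)
      refine Continuous.div ?_ ?_ fun l => (hsum _ (hGK _)).ne'
      · exact (hwc _).comp (hG.comp hS)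
      · exact continuous_finsetSum _ fun b _ => (hwc _).comp (hG.comp hS)
    have hΦb : ∀ l, ‖Φ l‖ ≤ √(Fintype.card t) := by
      intro l
      rw [EuclideanSpace.norm_eq]
      apply Real.sqrt_le_sqrt
      calc ∑ a : t, ‖Φ l a‖ ^ 2 ≤ ∑ a : t, (1:ℝ) := by
            refine Finset.sum_le_sum fun a _ => ?_
            have h1 : 0 ≤ Φ l a := div_nonneg (hw0 _ _) (hsum _ (hGK _)).le
            have h2 : Φ l a ≤ 1 := by
              refine (div_le_one (hsum _ (hGK _))).2 ?_
              exact Finset.single_le_sum (f := fun b : t => wt b (G (S l)))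
                (fun b _ => hw0 _ _) (Finset.mem_univ a)
            rw [Real.norm_of_nonneg h1]
            nlinarith
        _ = Fintype.card t := by simp
    obtain ⟨l, hl⟩ := exists_fixedPoint_of_bounded hΦ hΦb
    refine ⟨S l, ?_⟩
    have hla : ∀ a : t, l a = wt a (G (S l)) / ∑ b : t, wt b (G (S l)) := by
      intro a
      nth_rewrite 1 [← hl]
      rfl
    set y := G (S l) with hy
    have hWpos := hsum y (hGK _)
    have hl1 : ∑ a : t, l a = 1 := by
      simp_rw [hla, ← Finset.sum_div]
      exact div_self hWpos.ne'
    have hl0 : ∀ a : t, 0 ≤ l a := fun a => by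
      rw [hla]; exact div_nonneg (hw0 _ _) hWpos.le
    have hdiff : S l - y = ∑ a : t, l a • ((a : X) - y) := by
      simp_rw [smul_sub, Finset.sum_sub_distrib, ← Finset.sum_smul, hl1, one_smul]
      rfl
    rw [hdiff]
    calc ‖∑ a : t, l a • ((a : X) - y)‖ ≤ ∑ a : t, ‖l a • ((a : X) - y)‖ := norm_sum_le _ _
      _ ≤ ∑ a : t, l a * ε := by
          refine Finset.sum_le_sum fun a _ => ?_
          rw [norm_smul, Real.norm_of_nonneg (hl0 a)]
          by_cases h : ‖y - a‖ ≤ ε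
          · rw [norm_sub_rev]
            exact mul_le_mul_of_nonneg_left h (hl0 a)
          · have : wt a y = 0 := max_eq_right (by linarith)
            rw [hla, this]
            simp
      _ = ε := by rw [← Finset.sum_mul, hl1, one_mul]
  choose x hx using fun n : ℕ => happrox (1 / ((n : ℝ) + 1)) (by positivity)
  obtain ⟨y, -, θ, hθ, hy⟩ := hK.tendsto_subseq fun n => hGK (x n)
  have h0 : Tendsto (fun n => x (θ n) - G (x (θ n))) atTop (nhds 0) := by
    refine squeeze_zero_norm (fun n => hx (θ n)) ?_
    exact (tendsto_one_div_add_atTop_nhds_zero_nat (𝕜 := ℝ)).comp hθ.tendsto_atTop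
  have hxy : Tendsto (fun n => x (θ n)) atTop (nhds y) := by
    simpa using h0.add hy
  exact ⟨y, tendsto_nhds_unique ((hG.tendsto y).comp hxy) hy⟩

/-- Uniformly bounded and uniformly Lipschitz functions on a compact interval form a compact
set. -/
lemma isCompact_setOf_lipschitz_bounded {a b : ℝ} (L : NNReal) (M : ℝ) :
    IsCompact {y : C(Icc a b, ℝ) | LipschitzWith L y ∧ ∀ t, |y t| ≤ M} := by
  refine ArzelaAscoli.isCompact_of_equicontinuous _ ?_ ?_
  · have hset : ContinuousMap.toFun '' {y : C(Icc a b, ℝ) | LipschitzWith L y ∧ ∀ t, |y t| ≤ M} =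
        (univ.pi fun _ => Icc (-M) M) ∩ {y : Icc a b → ℝ | LipschitzWith L y} := by
      ext y
      constructor
      · rintro ⟨z, ⟨hz1, hz2⟩, rfl⟩
        exact ⟨fun t _ => abs_le.1 (hz2 t), hz1⟩
      · rintro ⟨h1, h2⟩
        exact ⟨⟨y, h2.continuous⟩, ⟨h2, fun t => abs_le.2 (h1 t (mem_univ t))⟩, rfl⟩
    rw [hset]
    refine (isCompact_univ_pi fun _ => isCompact_Icc).inter_right ?_
    exact isClosed_setOfPred_lipschitzWith L
  · exact (LipschitzWith.uniformEquicontinuous _ L fun y => y.2.1).equicontinuous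

/-- Superposition of a Carathéodory function with a measurable function is measurable. -/
lemma aestronglyMeasurable_superposition {T : ℝ} {h : ℝ → ℝ → ℝ}
    (hm : ∀ u : ℝ, Measurable fun t => h t u) (hc : ∀ᵐ t ∂(muT T), Continuous fun u => h t u)
    {u : ℝ → ℝ} (hu : AEMeasurable u (muT T)) :
    AEStronglyMeasurable (fun t => h t (u t)) (muT T) := by
  obtain ⟨S, hSae, hSm, hS⟩ := hc.exists_measurable_mem
  have hmeas : Measurable
      (Function.uncurry fun (x : ℝ) (t : ℝ) => S.indicator (fun t => h t x) t) :=
    measurable_uncurry_of_continuous_of_measurable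
      (fun t => by
        by_cases ht : t ∈ S
        · simpa [ht] using hS t ht
        · simpa [ht] using continuous_const)
      fun x => (hm x).indicator hSm
  have hcomp : Measurable fun t => S.indicator (fun τ => h τ (hu.mk u t)) t :=
    hmeas.comp (hu.measurable_mk.prodMk measurable_id)
  refine hcomp.stronglyMeasurable.aestronglyMeasurable.congr ?_
  filter_upwards [hu.ae_eq_mk, hSae] with t ht htS
  rw [indicator_of_mem htS, ht]

lemma muT_eq_restrict_Ioc (T : ℝ) : muT T = volume.restrict (Ioc 0 T) :=
  (Measure.restrict_congr_set Ioc_ae_eq_Icc).symm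

/-- The superposition of a dominated Carathéodory function with a continuous function is
integrable. -/
lemma integrableOn_superposition {T : ℝ} {h : ℝ → ℝ → ℝ} {γ : ℝ → ℝ}
    (hm : ∀ u : ℝ, Measurable fun t => h t u) (hc : ∀ᵐ t ∂(muT T), Continuous fun u => h t u)
    (hγ : IntegrableOn γ (Icc 0 T)) {u : ℝ → ℝ} (hu : ContinuousOn u (Icc 0 T))
    (hb : ∀ᵐ t ∂(muT T), |h t (u t)| ≤ γ t) :
    IntegrableOn (fun t => h t (u t)) (Icc 0 T) :=
  Integrable.mono' hγ
    (aestronglyMeasurable_superposition hm hc (hu.aemeasurable measurableSet_Icc)) hb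

/-- The indefinite integral of a dominated superposition depends continuously on the function and
on the endpoint. -/
lemma continuous_integral_superposition {T : ℝ} (hT : 0 ≤ T) {h : ℝ → ℝ → ℝ} {γ : ℝ → ℝ}
    (hm : ∀ u : ℝ, Measurable fun t => h t u) (hc : ∀ᵐ t ∂(muT T), Continuous fun u => h t u)
    (hγ : IntegrableOn γ (Icc 0 T)) (hb : ∀ᵐ t ∂(muT T), ∀ u, |h t u| ≤ γ t) :
    Continuous fun p : C(Icc (0 : ℝ) T, ℝ) × Icc (0 : ℝ) T =>
      ∫ τ in (0 : ℝ)..p.2, h τ (IccExtend hT p.1 τ) := by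
  have hrw : ∀ p : C(Icc (0 : ℝ) T, ℝ) × Icc (0 : ℝ) T,
      (∫ τ in (0 : ℝ)..p.2, h τ (IccExtend hT p.1 τ)) =
        ∫ τ, (Iic (p.2 : ℝ)).indicator (fun τ => h τ (IccExtend hT p.1 τ)) τ ∂(muT T) := by
    intro p
    rw [intervalIntegral.integral_of_le p.2.2.1, integral_indicator measurableSet_Iic,
      muT_eq_restrict_Ioc, Measure.restrict_restrict measurableSet_Iic]
    congr 2
    ext τ
    simp only [mem_inter_iff, mem_Iic, mem_Ioc]
    exact ⟨fun h => ⟨h.2, h.1, h.2.trans p.2.2.2⟩, fun h => ⟨h.2.1, h.1⟩⟩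
  simp only [hrw]
  rw [continuous_iff_continuousAt]
  intro p
  refine continuousAt_of_dominated (bound := γ) ?_ ?_ hγ ?_
  · refine Eventually.of_forall fun q => ?_
    refine (aestronglyMeasurable_superposition hm hc ?_).indicator measurableSet_Iic
    exact (q.1.continuous.Icc_extend' (h := hT)).aemeasurable
  · refine Eventually.of_forall fun q => ?_
    filter_upwards [hb] with τ hτ
    exact (norm_indicator_le_norm_self _ _).trans (hτ _)
  · have hne : ∀ᵐ τ ∂(muT T), τ ≠ (p.2 : ℝ) := by
      refine ae_restrict_of_ae ?_
      simp [ae_iff]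
    filter_upwards [hc, hne] with τ hτ hτp
    have hcont : Continuous fun q : C(Icc (0 : ℝ) T, ℝ) × Icc (0 : ℝ) T =>
        h τ (IccExtend hT q.1 τ) := by
      refine hτ.comp ?_
      simp only [IccExtend, Function.comp]
      exact (continuous_eval_const (projIcc 0 T hT τ)).comp continuous_fst
    have hp2 : Continuous fun q : C(Icc (0 : ℝ) T, ℝ) × Icc (0 : ℝ) T => (q.2 : ℝ) :=
      continuous_subtype_val.comp continuous_snd
    rcases lt_or_gt_of_ne hτp with hlt | hlt
    · refine hcont.continuousAt.congr ?_
      filter_upwards [hp2.continuousAt.eventually (lt_mem_nhds hlt)] with q hq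
      rw [indicator_of_mem (show τ ∈ Iic (q.2 : ℝ) from le_of_lt hq)]
    · refine (continuousAt_const (y := (0 : ℝ))).congr ?_
      filter_upwards [hp2.continuousAt.eventually (gt_mem_nhds hlt)] with q hq
      rw [indicator_of_notMem (show τ ∉ Iic (q.2 : ℝ) from not_le.2 hq)]

/-- The derivative profile `ψ (κ - F y + σ τ - ∫₀^τ h(x, y x) dx)` prescribed by the integrated
equation. -/
def derivProfile {T : ℝ} (hT : 0 ≤ T) (ψ F : ℝ → ℝ) (h : ℝ → ℝ → ℝ)
    (y : C(Icc (0 : ℝ) T, ℝ)) (κ σ τ : ℝ) :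
    ℝ :=
  ψ (κ - F (IccExtend hT y τ) + σ * τ -
    ∫ x in (0 : ℝ)..(projIcc 0 T hT τ : ℝ), h x (IccExtend hT y x))

section DerivProfile

variable {T : ℝ} {hT : 0 ≤ T} {ψ F : ℝ → ℝ} {h : ℝ → ℝ → ℝ} {γ : ℝ → ℝ}

lemma continuous_derivProfile (hψ : Continuous ψ) (hF : Continuous F)
    (hm : ∀ u : ℝ, Measurable fun t => h t u) (hc : ∀ᵐ t ∂(muT T), Continuous fun u => h t u)
    (hγ : IntegrableOn γ (Icc 0 T)) (hb : ∀ᵐ t ∂(muT T), ∀ u, |h t u| ≤ γ t) :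
    Continuous fun p : (C(Icc (0 : ℝ) T, ℝ) × ℝ × ℝ) × ℝ =>
      derivProfile hT ψ F h p.1.1 p.1.2.1 p.1.2.2 p.2 := by
  have hproj : Continuous fun p : (C(Icc (0 : ℝ) T, ℝ) × ℝ × ℝ) × ℝ => projIcc 0 T hT p.2 :=
    continuous_projIcc.comp continuous_snd
  have hy : Continuous fun p : (C(Icc (0 : ℝ) T, ℝ) × ℝ × ℝ) × ℝ => p.1.1 := by fun_prop
  have h1 : Continuous fun p : (C(Icc (0 : ℝ) T, ℝ) × ℝ × ℝ) × ℝ => IccExtend hT p.1.1 p.2 :=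
    hy.eval hproj
  have h2 := (continuous_integral_superposition hT hm hc hγ hb).comp (hy.prodMk hproj)
  simp only [Function.comp_def] at h2
  unfold derivProfile
  fun_prop

lemma continuous_integral_derivProfile (hψ : Continuous ψ) (hF : Continuous F)
    (hm : ∀ u : ℝ, Measurable fun t => h t u) (hc : ∀ᵐ t ∂(muT T), Continuous fun u => h t u)
    (hγ : IntegrableOn γ (Icc 0 T)) (hb : ∀ᵐ t ∂(muT T), ∀ u, |h t u| ≤ γ t) :
    Continuous fun p : (C(Icc (0 : ℝ) T, ℝ) × ℝ × ℝ) × ℝ =>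
      ∫ τ in (0 : ℝ)..p.2, derivProfile hT ψ F h p.1.1 p.1.2.1 p.1.2.2 τ := by
  refine intervalIntegral.continuous_parametric_intervalIntegral_of_continuous
    (f := fun (p : (C(Icc (0 : ℝ) T, ℝ) × ℝ × ℝ) × ℝ) τ =>
      derivProfile hT ψ F h p.1.1 p.1.2.1 p.1.2.2 τ) ?_ continuous_snd
  exact (continuous_derivProfile hψ hF hm hc hγ hb).comp
    ((continuous_fst.comp continuous_fst).prodMk continuous_snd)

lemma abs_integral_superposition_le (hγ : IntegrableOn γ (Icc 0 T))
    (hb : ∀ᵐ t ∂(muT T), ∀ u, |h t u| ≤ γ t) (u : ℝ → ℝ) {t : ℝ} (ht : t ∈ Icc 0 T) :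
    |∫ x in (0 : ℝ)..t, h x (u x)| ≤ ∫ x in (0 : ℝ)..T, γ x := by
  have hb' : ∀ᵐ x ∂(volume.restrict (Ioc 0 T)), ∀ u, |h x u| ≤ γ x := by
    rwa [← muT_eq_restrict_Ioc]
  have hγ' : IntegrableOn γ (Ioc 0 T) := hγ.mono_set Ioc_subset_Icc_self
  have h0 : |∫ x in (0 : ℝ)..t, h x (u x)| ≤ ∫ x in (0 : ℝ)..t, γ x := by
    rw [← Real.norm_eq_abs]
    refine intervalIntegral.norm_integral_le_of_norm_le ht.1 ?_ ?_
    · have := (ae_restrict_iff' measurableSet_Ioc).1 hb'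
      filter_upwards [this] with x hx hxt
      exact hx ⟨hxt.1, hxt.2.trans ht.2⟩ _
    · rw [intervalIntegrable_iff_integrableOn_Ioc_of_le ht.1]
      exact hγ'.mono_set (Ioc_subset_Ioc_right ht.2)
  refine h0.trans ?_
  rw [intervalIntegral.integral_of_le ht.1, intervalIntegral.integral_of_le (ht.1.trans ht.2)]
  refine setIntegral_mono_set hγ' ?_ (Ioc_subset_Ioc_right ht.2).eventuallyLE
  filter_upwards [hb'] with x hx
  exact (abs_nonneg _).trans (hx 0)

end DerivProfile

/-- Solvability of the truncated integrated problem, with one free additive parameter `σ` and one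
free level `r ∈ [0,1]` above the reference function `α`, related by a complementarity
condition. -/
lemma exists_truncated_solution {T : ℝ} (hT : 0 < T) {ψ F : ℝ → ℝ} {h : ℝ → ℝ → ℝ} {γ : ℝ → ℝ}
    (hψ : Continuous ψ) (hψm : StrictMono ψ) (hψ0 : ψ 0 = 0)
    (hF : Continuous F) {M : ℝ} (hM : ∀ x, |F x| ≤ M)
    (hm : ∀ u : ℝ, Measurable fun t => h t u) (hc : ∀ᵐ t ∂(muT T), Continuous fun u => h t u)
    (hγ : IntegrableOn γ (Icc 0 T)) (hb : ∀ᵐ t ∂(muT T), ∀ u, |h t u| ≤ γ t)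
    {α : ℝ → ℝ} (hα : ContinuousOn α (Icc 0 T)) (c s : ℝ) :
    ∃ (u : ℝ → ℝ) (κ σ r : ℝ), Continuous u ∧ 0 ≤ r ∧ r ≤ 1 ∧
      (∀ t ∈ Icc 0 T, u t = u 0 + ∫ τ in (0 : ℝ)..t,
        ψ (κ - F (u τ) + σ * τ - ∫ x in (0 : ℝ)..τ, h x (u x))) ∧
      u T = u 0 ∧ (∫ x in (0 : ℝ)..T, h x (u x)) = σ * T ∧
      (∀ t ∈ Icc 0 T, α t + r * c ≤ u t) ∧ (∃ t ∈ Icc 0 T, u t = α t + r * c) ∧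
      (σ < s → r = 0) ∧ (s < σ → r = 1) := by
  set Γ : ℝ := ∫ x in (0 : ℝ)..T, γ x with hΓ
  set B : ℝ := M + 2 * Γ + 1 with hB
  have hT0 : (0 : ℝ) ∈ Icc 0 T := ⟨le_rfl, hT.le⟩
  have hTT : T ∈ Icc 0 T := ⟨hT.le, le_rfl⟩
  have hM0 : 0 ≤ M := (abs_nonneg _).trans (hM 0)
  have hΓ0 : 0 ≤ Γ := (abs_nonneg _).trans (abs_integral_superposition_le hγ hb (fun _ => 0) hTT)
  have hB0 : 0 < B := by positivity
  set W : ℝ := B + M + 2 * Γ with hW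
  set L : ℝ := max |ψ W| |ψ (-W)| with hL
  have hL0 : 0 ≤ L := (abs_nonneg _).trans (le_max_left _ _)
  obtain ⟨A, hA⟩ : ∃ A, ∀ t ∈ Icc 0 T, |α t| ≤ A :=
    isCompact_Icc.exists_bound_of_continuousOn hα
  -- the ingredients of the fixed point map
  let X := C(Icc (0 : ℝ) T, ℝ) × ℝ × ℝ
  let clB : ℝ → ℝ := fun x => max (-B) (min B x)
  let cl1 : ℝ → ℝ := fun x => max 0 (min 1 x)
  have hclB : Continuous clB := by fun_prop
  have hcl1 : Continuous cl1 := by fun_prop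
  have hclBmem : ∀ x, clB x ∈ Icc (-B) B := fun x =>
    ⟨le_max_left _ _, max_le (by linarith) (min_le_left _ _)⟩
  have hcl1mem : ∀ x, cl1 x ∈ Icc (0 : ℝ) 1 := fun x =>
    ⟨le_max_left _ _, max_le (by linarith) (min_le_left _ _)⟩
  let sg : C(Icc (0 : ℝ) T, ℝ) → ℝ := fun y => (∫ x in (0 : ℝ)..T, h x (IccExtend hT.le y x)) / T
  have hsg : Continuous sg := by
    have := (continuous_integral_superposition hT.le hm hc hγ hb).comp
      (continuous_id.prodMk (continuous_const (y := (⟨T, hTT⟩ : Icc (0 : ℝ) T))))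
    exact this.div_const T
  let S : X → ℝ → ℝ := fun p τ => derivProfile hT.le ψ F h p.1 (clB p.2.1) (sg p.1) τ
  let Q : X → ℝ → ℝ := fun p t => ∫ τ in (0 : ℝ)..t, S p τ
  have hpar : Continuous fun p : X => ((p.1, clB p.2.1, sg p.1) : X) :=
    continuous_fst.prodMk ((hclB.comp (continuous_fst.comp continuous_snd)).prodMk
      (hsg.comp continuous_fst))
  have hS : Continuous fun q : X × ℝ => S q.1 q.2 :=
    (continuous_derivProfile hψ hF hm hc hγ hb).comp
      ((hpar.comp continuous_fst).prodMk continuous_snd)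
  have hQ : Continuous fun q : X × ℝ => Q q.1 q.2 :=
    (continuous_integral_derivProfile hψ hF hm hc hγ hb).comp
      ((hpar.comp continuous_fst).prodMk continuous_snd)
  have hSi : ∀ p a b, IntervalIntegrable (S p) volume a b := fun p a b =>
    (hS.comp (continuous_const.prodMk continuous_id)).intervalIntegrable a b
  have hαI : Continuous fun t : Icc (0 : ℝ) T => α t := hα.domRestrict
  have hQI : Continuous fun q : X × Icc (0 : ℝ) T => Q q.1 q.2 :=
    hQ.comp (continuous_fst.prodMk (continuous_subtype_val.comp continuous_snd))
  let m : X → ℝ := fun p => sInf ((fun t : Icc (0 : ℝ) T => Q p t - α t) '' univ)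
  have hmc : Continuous m :=
    isCompact_univ.continuous_sInf (f := fun p (t : Icc (0 : ℝ) T) => Q p t - α t)
      (hQI.sub (hαI.comp continuous_snd))
  have hmex : ∀ p, ∃ t : Icc (0 : ℝ) T, m p = Q p t - α t ∧
      ∀ t' : Icc (0 : ℝ) T, m p ≤ Q p t' - α t' := by
    intro p
    have hcont : Continuous fun t : Icc (0 : ℝ) T => Q p t - α t :=
      (hQI.comp (continuous_const.prodMk continuous_id)).sub hαI
    obtain ⟨t, -, ht1, ht2⟩ := isCompact_univ.exists_sInf_image_eq_and_le
      (⟨⟨0, hT0⟩, mem_univ _⟩) hcont.continuousOn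
    exact ⟨t, ht1, fun t' => ht1.trans_le (ht2 t' (mem_univ _))⟩
  have hPb : ∀ (y : C(Icc (0 : ℝ) T, ℝ)), ∀ t ∈ Icc 0 T,
      |∫ x in (0 : ℝ)..t, h x (IccExtend hT.le y x)| ≤ Γ := fun y t ht =>
    abs_integral_superposition_le hγ hb _ ht
  have hsgb : ∀ y, ∀ t ∈ Icc 0 T, |sg y * t| ≤ Γ := by
    intro y t ht
    have h1 : |sg y * T| ≤ Γ := by
      simp only [sg, div_mul_cancel₀ _ hT.ne']
      exact hPb y T hTT
    refine le_trans ?_ h1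
    rw [abs_mul, abs_mul, abs_of_nonneg ht.1, abs_of_pos hT]
    exact mul_le_mul_of_nonneg_left ht.2 (abs_nonneg _)
  have hSb : ∀ p : X, ∀ t ∈ Icc 0 T, |S p t| ≤ L := by
    intro p t ht
    have h1 := abs_le.1 (hM (IccExtend hT.le p.1 t))
    have h2 := abs_le.1 (hsgb p.1 t ht)
    have h3 := abs_le.1 (hPb p.1 _ (projIcc 0 T hT.le t).2)
    have h4 := hclBmem p.2.1
    simp only [S, derivProfile]
    set V := clB p.2.1 - F (IccExtend hT.le p.1 t) + sg p.1 * t -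
      ∫ x in (0 : ℝ)..(projIcc 0 T hT.le t : ℝ), h x (IccExtend hT.le p.1 x) with hV
    have hV1 : ψ V ≤ ψ W := hψm.monotone (by linarith [h4.2])
    have hV2 : ψ (-W) ≤ ψ V := hψm.monotone (by linarith [h4.1])
    refine abs_le.2 ⟨?_, ?_⟩
    · linarith [neg_abs_le (ψ (-W)), le_max_right |ψ W| |ψ (-W)|]
    · linarith [le_abs_self (ψ W), le_max_left |ψ W| |ψ (-W)|]
  have hQlip : ∀ p : X, ∀ t ∈ Icc 0 T, ∀ t' ∈ Icc 0 T, |Q p t - Q p t'| ≤ L * |t - t'| := by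
    intro p t ht t' ht'
    have : Q p t - Q p t' = ∫ τ in t'..t, S p τ :=
      intervalIntegral.integral_interval_sub_left (hSi _ _ _) (hSi _ _ _)
    rw [this, ← Real.norm_eq_abs]
    refine intervalIntegral.norm_integral_le_of_norm_le_const fun x hx => ?_
    refine hSb p x ?_
    rcases uIoc_subset_uIcc hx with ⟨h1, h2⟩
    exact ⟨(le_min ht'.1 ht.1).trans h1, h2.trans (max_le ht'.2 ht.2)⟩
  have hQ0 : ∀ p, Q p 0 = 0 := fun p => intervalIntegral.integral_same
  have hQb : ∀ p : X, ∀ t ∈ Icc 0 T, |Q p t| ≤ L * T := by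
    intro p t ht
    have := hQlip p t ht 0 hT0
    rw [hQ0, sub_zero, sub_zero, abs_of_nonneg ht.1] at this
    exact this.trans (mul_le_mul_of_nonneg_left ht.2 hL0)
  let Y : X → C(Icc (0 : ℝ) T, ℝ) := fun p =>
    ⟨fun t => Q p t - m p + cl1 p.2.2 * c,
      ((hQI.comp (continuous_const.prodMk continuous_id)).sub continuous_const).add
        continuous_const⟩
  have hY : Continuous Y := by
    refine ContinuousMap.continuous_of_continuous_uncurry Y ?_
    exact (hQI.sub (hmc.comp continuous_fst)).add
      (((hcl1.comp (continuous_snd.comp (continuous_snd.comp continuous_fst)))).mul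
        continuous_const)
  let N : X → X := fun p => (Y p, clB (p.2.1 - Q p T), cl1 (p.2.2 + sg p.1 - s))
  have hN : Continuous N := by
    refine hY.prodMk (Continuous.prodMk ?_ ?_)
    · exact hclB.comp ((continuous_fst.comp continuous_snd).sub
        (hQ.comp (continuous_id.prodMk continuous_const)))
    · exact hcl1.comp (((continuous_snd.comp continuous_snd).add
        (hsg.comp continuous_fst)).sub continuous_const)
  obtain ⟨p, hp⟩ := exists_fixedPoint_of_range_subset_compact hN
    ((isCompact_setOf_lipschitz_bounded (a := 0) (b := T) ⟨L, hL0⟩ (L * T + (L * T + A) + |c|)).prod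
      ((isCompact_Icc (a := -B) (b := B)).prod (isCompact_Icc (a := (0 : ℝ)) (b := 1))))
    (by
      intro p
      refine ⟨⟨?_, ?_⟩, hclBmem _, hcl1mem _⟩
      · refine LipschitzWith.of_dist_le_mul fun t t' => ?_
        have := hQlip p t t.2 t' t'.2
        have heq : (N p).1 t - (N p).1 t' = Q p t - Q p t' := by
          change (Q p t - m p + cl1 p.2.2 * c) - (Q p t' - m p + cl1 p.2.2 * c) = _
          ring
        rwa [Real.dist_eq, heq]
      · intro t
        obtain ⟨t₁, ht₁, -⟩ := hmex p
        have h1 := abs_le.1 (hQb p t t.2)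
        have h2 := abs_le.1 (hQb p t₁ t₁.2)
        have h3 := abs_le.1 (hA t₁ t₁.2)
        have h4 : |cl1 p.2.2 * c| ≤ |c| := by
          rw [abs_mul, abs_of_nonneg (hcl1mem p.2.2).1]
          exact mul_le_of_le_one_left (abs_nonneg _) (hcl1mem p.2.2).2
        have h5 := abs_le.1 h4
        change |Q p t - m p + cl1 p.2.2 * c| ≤ _
        rw [ht₁]
        exact abs_le.2 ⟨by linarith [h1.1, h2.2, h3.1, h5.1], by linarith [h1.2, h2.1, h3.2, h5.2]⟩)
  obtain ⟨y, κ, r⟩ := p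
  set p : X := (y, κ, r) with hpdef
  have hp1 : Y p = y := congrArg Prod.fst hp
  have hp2 : clB (κ - Q p T) = κ := congrArg (fun q : X => q.2.1) hp
  have hp3 : cl1 (r + sg y - s) = r := congrArg (fun q : X => q.2.2) hp
  have hκ : κ ∈ Icc (-B) B := hp2 ▸ hclBmem _
  have hr : r ∈ Icc (0 : ℝ) 1 := hp3 ▸ hcl1mem _
  have hclκ : clB κ = κ := by
    simp only [clB, min_eq_right hκ.2, max_eq_right hκ.1]
  have hclr : cl1 r = r := by
    simp only [cl1, min_eq_right hr.2, max_eq_right hr.1]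
  set u : ℝ → ℝ := IccExtend hT.le y with hu
  have huy : ∀ t (ht : t ∈ Icc 0 T), u t = Q p t - m p + r * c := by
    intro t ht
    rw [hu, IccExtend_of_mem _ _ ht]
    conv_lhs => rw [← hp1]
    change Q p t - m p + cl1 r * c = _
    rw [hclr]
  have hSp : ∀ t ∈ Icc 0 T, S p t =
      ψ (κ - F (u t) + sg y * t - ∫ x in (0 : ℝ)..t, h x (u x)) := by
    intro t ht
    simp only [S, derivProfile, projIcc_of_mem _ ht]
    change ψ (clB κ - _ + _ - _) = _
    rw [hclκ]
  have hSarg : ∀ t ∈ Icc 0 T, |(κ - F (u t) + sg y * t - ∫ x in (0 : ℝ)..t, h x (u x)) - κ| ≤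
      M + 2 * Γ := by
    intro t ht
    have h1 := abs_le.1 (hM (u t))
    have h2 := abs_le.1 (hsgb y t ht)
    have h3 := abs_le.1 (hPb y t ht)
    exact abs_le.2 ⟨by linarith, by linarith⟩
  have hQT : Q p T = 0 := by
    rcases lt_trichotomy (Q p T) 0 with hlt | heq | hgt
    · exfalso
      have hκB : κ = B := by
        by_contra hne
        have hκlt : κ < B := lt_of_le_of_ne hκ.2 hne
        rcases min_choice B (κ - Q p T) with h1 | h1
        · simp only [clB, h1] at hp2
          exact hne (by rw [← hp2, max_eq_right (by linarith)])
        · simp only [clB, h1] at hp2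
          have := le_max_right (-B) (κ - Q p T)
          linarith
      have : 0 ≤ Q p T := intervalIntegral.integral_nonneg hT.le fun t ht => by
        rw [hSp t ht]
        have := abs_le.1 (hSarg t ht)
        exact hψ0.symm.trans_le (hψm.monotone (by linarith [this.1]))
      linarith
    · exact heq
    · exfalso
      have hκB : κ = -B := by
        by_contra hne
        have hκlt : -B < κ := lt_of_le_of_ne hκ.1 (Ne.symm hne)
        have h1 : min B (κ - Q p T) ≤ κ - Q p T := min_le_right _ _
        have h2 : max (-B) (min B (κ - Q p T)) < κ := max_lt hκlt (by linarith)
        exact absurd hp2 h2.ne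
      have : Q p T ≤ 0 := by
        have : 0 ≤ ∫ τ in (0 : ℝ)..T, -S p τ :=
          intervalIntegral.integral_nonneg hT.le fun t ht => by
            rw [hSp t ht, neg_nonneg]
            have := abs_le.1 (hSarg t ht)
            exact (hψm.monotone (by linarith [this.2])).trans_eq hψ0
        rw [intervalIntegral.integral_neg] at this
        exact neg_nonneg.1 this
      linarith
  have hu0 : u 0 = - m p + r * c := by rw [huy 0 hT0, hQ0, zero_sub]
  refine ⟨u, κ, sg y, r, y.continuous.Icc_extend', hr.1, hr.2, ?_, ?_, ?_, ?_, ?_, ?_, ?_⟩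
  · intro t ht
    have : (∫ τ in (0 : ℝ)..t, ψ (κ - F (u τ) + sg y * τ - ∫ x in (0 : ℝ)..τ, h x (u x))) =
        Q p t := by
      refine intervalIntegral.integral_congr fun τ hτ => ?_
      rw [uIcc_of_le ht.1] at hτ
      exact (hSp τ ⟨hτ.1, hτ.2.trans ht.2⟩).symm
    rw [this, huy t ht, hu0]
    ring
  · rw [huy T hTT, hu0, hQT, zero_sub]
  · simp only [sg, div_mul_cancel₀ _ hT.ne']
    rfl
  · intro t ht
    obtain ⟨-, -, h2⟩ := hmex p
    have := h2 ⟨t, ht⟩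
    rw [huy t ht]
    linarith
  · obtain ⟨t, ht, -⟩ := hmex p
    refine ⟨t, t.2, ?_⟩
    rw [huy t t.2, ht]
    ring
  · intro hσ
    by_contra hne
    have hrpos : 0 < r := lt_of_le_of_ne hr.1 (Ne.symm hne)
    have h1 : min 1 (r + sg y - s) ≤ r + sg y - s := min_le_right _ _
    have h2 : max 0 (min 1 (r + sg y - s)) < r := max_lt hrpos (by linarith)
    exact absurd hp3 h2.ne
  · intro hσ
    by_contra hne
    have hrlt : r < 1 := lt_of_le_of_ne hr.2 hne
    have h2 : r < max 0 (min 1 (r + sg y - s)) :=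
      lt_max_of_lt_right (lt_min hrlt (by linarith))
    exact absurd hp3 (Ne.symm h2.ne)

/-- `u` solves the periodic problem for `(φ(u'))' + (F(u))' + h(t,u) = σ` in integrated form. -/
def IsIntegratedSol (T : ℝ) (φ F : ℝ → ℝ) (h : ℝ → ℝ → ℝ) (σ : ℝ) (u u' : ℝ → ℝ) : Prop :=
  IsC1Periodic T u u' ∧ ∀ t ∈ Icc (0 : ℝ) T,
    φ (u' t) + F (u t) = φ (u' 0) + F (u 0) + (σ * t - ∫ τ in (0 : ℝ)..t, h τ (u τ))

lemma IsC1Periodic.continuousOn {T : ℝ} {u u' : ℝ → ℝ} (hu : IsC1Periodic T u u') :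
    ContinuousOn u (Icc 0 T) := fun t ht => (hu.1 t ht).continuousWithinAt

lemma intervalIntegrable_of_integrableOn_Icc {T a b : ℝ} {k : ℝ → ℝ}
    (hk : IntegrableOn k (Icc 0 T)) (ha : a ∈ Icc 0 T) (hb : b ∈ Icc 0 T) :
    IntervalIntegrable k volume a b := by
  rw [intervalIntegrable_iff]
  refine hk.mono_set fun x hx => ?_
  rcases uIoc_subset_uIcc hx with ⟨h1, h2⟩
  exact ⟨(le_min ha.1 hb.1).trans h1, h2.trans (max_le ha.2 hb.2)⟩

/-- A Carathéodory function composed with a continuous function is integrable. -/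
lemma Caratheodory.integrableOn {T : ℝ} {g : ℝ → ℝ → ℝ} (hg : Caratheodory T g) {u : ℝ → ℝ}
    (hu : ContinuousOn u (Icc 0 T)) : IntegrableOn (fun t => g t (u t)) (Icc 0 T) := by
  obtain ⟨A, hA⟩ := isCompact_Icc.exists_bound_of_continuousOn hu
  obtain ⟨γ, hγ, hb⟩ := hg.2.2 (|A| + 1) (by positivity)
  refine integrableOn_superposition hg.1 hg.2.1 hγ hu ?_
  have hmem : ∀ᵐ t ∂(muT T), t ∈ Icc 0 T := ae_restrict_mem measurableSet_Icc
  filter_upwards [hb, hmem] with t ht htm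
  refine ht _ ?_
  have h1 := hA t htm
  rw [Real.norm_eq_abs] at h1
  linarith [le_abs_self A]

lemma IsIntegratedSol.integral_eq {T : ℝ} (hT : 0 < T) {φ F : ℝ → ℝ} {h : ℝ → ℝ → ℝ} {σ : ℝ}
    {u u' : ℝ → ℝ} (hu : IsIntegratedSol T φ F h σ u u') :
    (∫ τ in (0 : ℝ)..T, h τ (u τ)) = σ * T := by
  have h1 := hu.2 T ⟨hT.le, le_rfl⟩
  rw [← hu.1.2.2.1, ← hu.1.2.2.2] at h1
  linarith

/-- A function given by integrating the derivative profile is a solution in integrated form. -/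
lemma isIntegratedSol_of_eq_integral {T : ℝ} (hT : 0 < T) {φ ψ F : ℝ → ℝ} {h : ℝ → ℝ → ℝ}
    (hψ : Continuous ψ) (hφψ : ∀ x, φ (ψ x) = x) (hF : Continuous F) {κ σ : ℝ} {u : ℝ → ℝ}
    (huc : ContinuousOn u (Icc 0 T)) (hintg : IntegrableOn (fun t => h t (u t)) (Icc 0 T))
    (hu : ∀ t ∈ Icc 0 T, u t = u 0 + ∫ τ in (0 : ℝ)..t,
      ψ (κ - F (u τ) + σ * τ - ∫ x in (0 : ℝ)..τ, h x (u x)))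
    (huT : u T = u 0) (hσ : (∫ x in (0 : ℝ)..T, h x (u x)) = σ * T) :
    IsIntegratedSol T φ F h σ u
      (fun t => ψ (κ - F (u t) + σ * t - ∫ x in (0 : ℝ)..t, h x (u x))) := by
  have hVc : ContinuousOn (fun t => ψ (κ - F (u t) + σ * t - ∫ x in (0 : ℝ)..t, h x (u x)))
      (Icc 0 T) := by
    have hP : ContinuousOn (fun t => ∫ x in (0 : ℝ)..t, h x (u x)) (Icc 0 T) := by
      have := intervalIntegral.continuousOn_primitive_interval (μ := volume)
        (f := fun t => h t (u t)) (a := 0) (b := T) (by rwa [uIcc_of_le hT.le])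
      rwa [uIcc_of_le hT.le] at this
    exact hψ.comp_continuousOn (((continuousOn_const.sub (hF.comp_continuousOn huc)).add
      (continuousOn_const.mul continuousOn_id)).sub hP)
  set V := fun t => ψ (κ - F (u t) + σ * t - ∫ x in (0 : ℝ)..t, h x (u x)) with hV
  refine ⟨⟨?_, hVc, huT.symm, ?_⟩, ?_⟩
  · have hS : Continuous (IccExtend hT.le ((Icc 0 T).domRestrict V)) :=
      hVc.domRestrict.Icc_extend'
    intro t ht
    have h1 : HasDerivAt
        (fun t => u 0 + ∫ τ in (0 : ℝ)..t, IccExtend hT.le ((Icc 0 T).domRestrict V) τ)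
        (V t) t := by
      have := (hS.integral_hasStrictDerivAt 0 t).hasDerivAt.const_add (u 0)
      rwa [IccExtend_of_mem _ _ ht] at this
    have heq : ∀ x ∈ Icc 0 T,
        u x = u 0 + ∫ τ in (0 : ℝ)..x, IccExtend hT.le ((Icc 0 T).domRestrict V) τ := by
      intro x hx
      conv_lhs => rw [hu x hx]
      congr 1
      refine intervalIntegral.integral_congr fun τ hτ => ?_
      rw [uIcc_of_le hx.1] at hτ
      have hτ' : τ ∈ Icc 0 T := ⟨hτ.1, hτ.2.trans hx.2⟩
      simp only [IccExtend_of_mem _ _ hτ']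
      rfl
    exact h1.hasDerivWithinAt.congr heq (heq t ht)
  · simp only [hV, hσ, huT, intervalIntegral.integral_same]
    congr 1
    ring
  · intro t _
    simp only [hV, hφψ, intervalIntegral.integral_same]
    ring

/-- Chain rule and fundamental theorem of calculus along a `C¹` curve. -/
lemma IsC1Periodic.integral_comp {T : ℝ} {f F u u' : ℝ → ℝ} (hf : Continuous f)
    (hF : ∀ x, HasDerivAt F (f x) x) (hu : IsC1Periodic T u u') {t : ℝ} (ht : t ∈ Icc 0 T) :
    (∫ τ in (0 : ℝ)..t, f (u τ) * u' τ) = F (u t) - F (u 0) := by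
  have hsub : Icc 0 t ⊆ Icc 0 T := Icc_subset_Icc_right ht.2
  refine intervalIntegral.integral_eq_sub_of_hasDerivAt_of_le (f := fun τ => F (u τ)) ht.1 ?_ ?_ ?_
  · exact (continuous_iff_continuousAt.2 fun x => (hF x).continuousAt).comp_continuousOn
      (hu.continuousOn.mono hsub)
  · intro x hx
    have h1 : HasDerivAt u (u' x) x :=
      (hu.1 x ⟨hx.1.le, hx.2.le.trans ht.2⟩).hasDerivAt
        (Icc_mem_nhds hx.1 (hx.2.trans_le ht.2))
    exact (hF (u x)).comp x h1
  · refine ContinuousOn.intervalIntegrable ?_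
    rw [uIcc_of_le ht.1]
    exact ((hf.comp_continuousOn hu.continuousOn).mul hu.2.1).mono hsub

lemma IsC1Periodic.integrableOn_comp {T : ℝ} {f u u' : ℝ → ℝ} (hf : Continuous f)
    (hu : IsC1Periodic T u u') : IntegrableOn (fun τ => f (u τ) * u' τ) (Icc 0 T) :=
  ((hf.comp_continuousOn hu.continuousOn).mul hu.2.1).integrableOn_compact isCompact_Icc

lemma IsIntegratedSol.isSolEs {T : ℝ} {φ f F : ℝ → ℝ} {g : ℝ → ℝ → ℝ}
    (hf : Continuous f) (hF : ∀ x, HasDerivAt F (f x) x) (hg : Caratheodory T g) {s : ℝ}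
    {u u' : ℝ → ℝ} (hu : IsIntegratedSol T φ F g s u u') : IsSolEs T φ f g s u := by
  have hgi := hg.integrableOn hu.1.continuousOn
  have hfi := hu.1.integrableOn_comp hf
  have hci : IntegrableOn (fun _ : ℝ => s) (Icc 0 T) := by simp
  refine ⟨u', fun t => s - g t (u t) - f (u t) * u' t, hu.1, ⟨(hci.sub hgi).sub hfi, ?_⟩, ?_⟩
  · intro t ht
    have h0 : (0 : ℝ) ∈ Icc 0 T := ⟨le_rfl, ht.1.trans ht.2⟩
    have hgi' := intervalIntegrable_of_integrableOn_Icc hgi h0 ht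
    have hfi' := intervalIntegrable_of_integrableOn_Icc hfi h0 ht
    have hci' := intervalIntegrable_of_integrableOn_Icc hci h0 ht
    rw [intervalIntegral.integral_sub (hci'.sub hgi') hfi', intervalIntegral.integral_sub hci' hgi',
      hu.1.integral_comp hf hF ht, intervalIntegral.integral_const, smul_eq_mul]
    have := hu.2 t ht
    linarith
  · exact Eventually.of_forall fun t => by ring

lemma exists_isIntegratedSol_of_isSolEs {T : ℝ} {φ f F : ℝ → ℝ} {g : ℝ → ℝ → ℝ}
    (hf : Continuous f) (hF : ∀ x, HasDerivAt F (f x) x) (hg : Caratheodory T g) {s : ℝ}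
    {u : ℝ → ℝ} (hu : IsSolEs T φ f g s u) : ∃ u', IsIntegratedSol T φ F g s u u' := by
  obtain ⟨u', w, hC, ⟨hw, hw'⟩, hae⟩ := hu
  refine ⟨u', hC, fun t ht => ?_⟩
  have hgi := hg.integrableOn hC.continuousOn
  have hfi := hC.integrableOn_comp hf
  have hci : IntegrableOn (fun _ : ℝ => s) (Icc 0 T) := by simp
  have h0 : (0 : ℝ) ∈ Icc 0 T := ⟨le_rfl, ht.1.trans ht.2⟩
  have hgi' := intervalIntegrable_of_integrableOn_Icc hgi h0 ht
  have hfi' := intervalIntegrable_of_integrableOn_Icc hfi h0 ht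
  have hci' := intervalIntegrable_of_integrableOn_Icc hci h0 ht
  have heq : (∫ τ in (0 : ℝ)..t, w τ) = ∫ τ in (0 : ℝ)..t, (s - g τ (u τ) - f (u τ) * u' τ) := by
    refine intervalIntegral.integral_congr_ae ?_
    have := (ae_restrict_iff' measurableSet_Icc).1 hae
    filter_upwards [this] with τ hτ hτt
    rw [uIoc_of_le ht.1] at hτt
    linarith [hτ ⟨hτt.1.le, hτt.2.trans ht.2⟩]
  rw [hw' t ht, heq, intervalIntegral.integral_sub (hci'.sub hgi') hfi',
    intervalIntegral.integral_sub hci' hgi', hC.integral_comp hf hF ht,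
    intervalIntegral.integral_const, smul_eq_mul]
  ring

/-- The derivative is nonpositive at a minimum point that is not the left endpoint. -/
lemma deriv_nonpos_of_min_left {T d t : ℝ} {v : ℝ → ℝ} (ht0 : 0 < t) (htT : t ≤ T)
    (hd : HasDerivWithinAt v d (Icc 0 T) t) (hmin : ∀ τ ∈ Icc 0 T, v t ≤ v τ) : d ≤ 0 := by
  have h1 : HasDerivWithinAt v d (Ico 0 t) t :=
    hd.mono fun x hx => ⟨hx.1, hx.2.le.trans htT⟩
  rw [hasDerivWithinAt_iff_tendsto_slope' (by simp)] at h1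
  have := right_nhdsWithin_Ico_neBot ht0
  refine le_of_tendsto h1 ?_
  filter_upwards [self_mem_nhdsWithin] with x hx
  rw [slope_def_field]
  exact div_nonpos_of_nonneg_of_nonpos (sub_nonneg.2 (hmin x ⟨hx.1, hx.2.le.trans htT⟩))
    (sub_nonpos.2 hx.2.le)

/-- The derivative is nonnegative at a minimum point that is not the right endpoint. -/
lemma deriv_nonneg_of_min_right {T d t : ℝ} {v : ℝ → ℝ} (ht0 : 0 ≤ t) (htT : t < T)
    (hd : HasDerivWithinAt v d (Icc 0 T) t) (hmin : ∀ τ ∈ Icc 0 T, v t ≤ v τ) : 0 ≤ d := by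
  have h1 : HasDerivWithinAt v d (Ioc t T) t :=
    hd.mono fun x hx => ⟨ht0.trans hx.1.le, hx.2⟩
  rw [hasDerivWithinAt_iff_tendsto_slope' (by simp)] at h1
  have := left_nhdsWithin_Ioc_neBot htT
  refine ge_of_tendsto h1 ?_
  filter_upwards [self_mem_nhdsWithin] with x hx
  rw [slope_def_field]
  exact div_nonneg (sub_nonneg.2 (hmin x ⟨ht0.trans hx.1.le, hx.2⟩)) (sub_nonneg.2 hx.1.le)

/-- One-sided a priori bound: if `φ(u') + F(u)` oscillates by at most `C`, then `φ(u') ≤ C`. -/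
lemma phi_deriv_le_of_oscillation {T : ℝ} (hT : 0 < T) {φ F : ℝ → ℝ} (hφ : StrictMono φ)
    (hφ0 : φ 0 = 0) {u u' : ℝ → ℝ} (hu : IsC1Periodic T u u') {C : ℝ}
    (hC : ∀ t₁ ∈ Icc 0 T, ∀ t₂ ∈ Icc 0 T,
      φ (u' t₁) + F (u t₁) - (φ (u' t₂) + F (u t₂)) ≤ C) :
    ∀ t ∈ Icc 0 T, φ (u' t) ≤ C := by
  intro t ht
  by_contra! hlt
  have hpos : ∀ τ ∈ Icc 0 T, u τ = u t → 0 < u' τ := by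
    intro τ hτ hττ
    have := hC t ht τ hτ
    rw [hττ] at this
    exact hφ.lt_iff_lt.1 (by linarith)
  have hforward : ∀ t₁ ∈ Icc 0 T, u t ≤ u t₁ → ∀ τ ∈ Icc t₁ T, u t ≤ u τ := by
    intro t₁ ht₁ hle τ hτ
    refine image_le_of_deriv_right_lt_deriv_boundary' (f := fun _ => u t) (f' := fun _ => 0)
      (B := u) (B' := u') continuousOn_const
      (fun x _ => hasDerivWithinAt_const x _ _) hle
      (hu.continuousOn.mono (Icc_subset_Icc_left ht₁.1)) (fun x hx => ?_) (fun x hx hxe => ?_) hτ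
    · refine (hu.1 x ⟨ht₁.1.trans hx.1, hx.2.le⟩).mono_of_mem_nhdsWithin ?_
      exact mem_of_superset (Icc_mem_nhdsGE hx.2) (Icc_subset_Icc_left (ht₁.1.trans hx.1))
    · exact hpos x ⟨ht₁.1.trans hx.1, hx.2.le⟩ hxe.symm
  have hTle : u t ≤ u T := hforward t ht le_rfl T ⟨ht.2, le_rfl⟩
  have hmin : ∀ τ ∈ Icc 0 T, u t ≤ u τ :=
    hforward 0 ⟨le_rfl, hT.le⟩ (hu.2.2.1 ▸ hTle)
  rcases eq_or_lt_of_le ht.1 with h0 | h0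
  · have hTt : u T = u t := by rw [← hu.2.2.1, h0]
    have h1 := deriv_nonpos_of_min_left hT le_rfl (hu.1 T ⟨hT.le, le_rfl⟩)
      (fun τ hτ => hTt ▸ hmin τ hτ)
    exact absurd (hpos T ⟨hT.le, le_rfl⟩ hTt) (not_lt.2 h1)
  · exact absurd (hpos t ht rfl)
      (not_lt.2 (deriv_nonpos_of_min_left h0 ht.2 (hu.1 t ht) hmin))

lemma abs_phi_deriv_le_of_oscillation {T : ℝ} (hT : 0 < T) {φ F : ℝ → ℝ} (hφ : StrictMono φ)
    (hφ0 : φ 0 = 0) {u u' : ℝ → ℝ} (hu : IsC1Periodic T u u') {C : ℝ}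
    (hC : ∀ t₁ ∈ Icc 0 T, ∀ t₂ ∈ Icc 0 T,
      φ (u' t₁) + F (u t₁) - (φ (u' t₂) + F (u t₂)) ≤ C) :
    ∀ t ∈ Icc 0 T, |φ (u' t)| ≤ C := by
  intro t ht
  refine abs_le.2 ⟨?_, phi_deriv_le_of_oscillation hT hφ hφ0 hu hC t ht⟩
  have hneg : IsC1Periodic T (fun t => -u t) (fun t => -u' t) :=
    ⟨fun t ht => (hu.1 t ht).neg, hu.2.1.neg, congrArg Neg.neg hu.2.2.1, congrArg Neg.neg hu.2.2.2⟩
  have := phi_deriv_le_of_oscillation hT (φ := fun x => -φ (-x)) (F := fun x => -F (-x)) (C := C)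
    (fun x y hxy => neg_lt_neg (hφ (neg_lt_neg hxy))) (by simp [hφ0]) hneg
    (fun t₁ ht₁ t₂ ht₂ => by
      simp only [neg_neg]
      linarith [hC t₂ ht₂ t₁ ht₁]) t ht
  simp only [neg_neg] at this
  linarith

/-- A priori bound for the derivative, uniform with respect to the damping term and the
nonlinearity. -/
lemma exists_deriv_bound {T : ℝ} (hT : 0 < T) {φ : ℝ → ℝ} (hφ : StrictMono φ)
    (hφsurj : Function.Surjective φ) (hφ0 : φ 0 = 0) {γ₀ : ℝ → ℝ}
    (hγ₀ : IntegrableOn γ₀ (Icc 0 T)) (hγ₀pos : ∀ᵐ t ∂(muT T), 0 ≤ γ₀ t) (s : ℝ) :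
    ∃ D : ℝ, 0 ≤ D ∧ ∀ (F : ℝ → ℝ) (h : ℝ → ℝ → ℝ) (u u' : ℝ → ℝ) (σ : ℝ), s ≤ σ →
      (∀ᵐ t ∂(muT T), ∀ x, h t x ≤ γ₀ t) → IntegrableOn (fun t => h t (u t)) (Icc 0 T) →
      IsIntegratedSol T φ F h σ u u' → ∀ t ∈ Icc 0 T, |u' t| ≤ D := by
  set G : ℝ := ∫ t in Icc 0 T, γ₀ t with hG
  obtain ⟨a, ha⟩ := hφsurj (2 * G + 2 * T * |s|)
  obtain ⟨b, hb⟩ := hφsurj (-(2 * G + 2 * T * |s|))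
  refine ⟨max |a| |b|, (abs_nonneg _).trans (le_max_left _ _), ?_⟩
  intro F h u u' σ hσ hle hintg hu t ht
  have hhσ : (∫ τ in Icc 0 T, h τ (u τ)) = σ * T := by
    rw [← hu.integral_eq hT, intervalIntegral.integral_of_le hT.le, integral_Icc_eq_integral_Ioc]
  have hci : IntegrableOn (fun _ : ℝ => |σ|) (Icc 0 T) := by simp
  have hci' : IntegrableOn (fun _ : ℝ => σ) (Icc 0 T) := by simp
  have hvol : (∫ _ in Icc 0 T, |σ|) = T * |σ| := by
    rw [setIntegral_const]
    simp [Measure.real, hT.le]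
  have hbound : (∫ τ in Icc 0 T, |σ - h τ (u τ)|) ≤ 2 * G + 2 * T * |s| := by
    have h1 : (∫ τ in Icc 0 T, |σ - h τ (u τ)|) ≤
        ∫ τ in Icc 0 T, (|σ| + (γ₀ τ + (γ₀ τ - h τ (u τ)))) := by
      refine integral_mono_ae (hci'.sub hintg).norm (hci.add (hγ₀.add (hγ₀.sub hintg))) ?_
      filter_upwards [hle, hγ₀pos] with τ h2 h3
      have h4 := h2 (u τ)
      refine abs_le.2 ⟨?_, ?_⟩
      · linarith [neg_abs_le σ]
      · linarith [le_abs_self σ]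
    have h2 : (∫ τ in Icc 0 T, (|σ| + (γ₀ τ + (γ₀ τ - h τ (u τ))))) =
        T * |σ| + (G + (G - σ * T)) := by
      have e1 := integral_add (μ := volume.restrict (Icc 0 T)) hci (hγ₀.add (hγ₀.sub hintg))
      have e2 := integral_add (μ := volume.restrict (Icc 0 T)) hγ₀ (hγ₀.sub hintg)
      have e3 := integral_sub (μ := volume.restrict (Icc 0 T)) hγ₀ hintg
      simp only [Pi.add_apply, Pi.sub_apply] at e1 e2 e3
      rw [e1, e2, e3, hvol, hhσ]
    have h3 : |σ| - σ ≤ 2 * |s| := by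
      rcases le_total 0 σ with h | h
      · rw [abs_of_nonneg h]; linarith [abs_nonneg s]
      · rw [abs_of_nonpos h]; linarith [neg_abs_le s]
    nlinarith
  have hosc : ∀ t₁ ∈ Icc 0 T, ∀ t₂ ∈ Icc 0 T,
      φ (u' t₁) + F (u t₁) - (φ (u' t₂) + F (u t₂)) ≤ 2 * G + 2 * T * |s| := by
    intro t₁ ht₁ t₂ ht₂
    refine le_trans ?_ hbound
    have h0 : (0 : ℝ) ∈ Icc 0 T := ⟨le_rfl, hT.le⟩
    have hσi : ∀ x ∈ Icc 0 T, IntervalIntegrable (fun τ => σ - h τ (u τ)) volume 0 x :=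
      fun x hx => intervalIntegrable_of_integrableOn_Icc (hci'.sub hintg) h0 hx
    have hprim : ∀ x ∈ Icc 0 T, σ * x - (∫ τ in (0 : ℝ)..x, h τ (u τ)) =
        ∫ τ in (0 : ℝ)..x, (σ - h τ (u τ)) := by
      intro x hx
      rw [intervalIntegral.integral_sub (intervalIntegrable_of_integrableOn_Icc hci' h0 hx)
        (intervalIntegrable_of_integrableOn_Icc hintg h0 hx), intervalIntegral.integral_const]
      simp [mul_comm]
    have heq : φ (u' t₁) + F (u t₁) - (φ (u' t₂) + F (u t₂)) =
        ∫ τ in t₂..t₁, (σ - h τ (u τ)) := by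
      rw [hu.2 t₁ ht₁, hu.2 t₂ ht₂, hprim t₁ ht₁, hprim t₂ ht₂,
        ← intervalIntegral.integral_interval_sub_left (hσi t₁ ht₁) (hσi t₂ ht₂)]
      ring
    rw [heq]
    refine (le_abs_self _).trans ?_
    rw [← Real.norm_eq_abs]
    refine intervalIntegral.norm_integral_le_integral_norm_uIoc.trans ?_
    refine setIntegral_mono_set (hci'.sub hintg).norm
      (Eventually.of_forall fun _ => norm_nonneg _) (LE.le.eventuallyLE ?_)
    intro x hx
    rcases uIoc_subset_uIcc hx with ⟨h1, h2⟩
    exact ⟨(le_min ht₂.1 ht₁.1).trans h1, h2.trans (max_le ht₂.2 ht₁.2)⟩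
  have hφb := abs_le.1 (abs_phi_deriv_le_of_oscillation hT hφ hφ0 hu.1 hosc t ht)
  have h1 : u' t ≤ a := hφ.le_iff_le.1 (ha ▸ hφb.2)
  have h2 : b ≤ u' t := hφ.le_iff_le.1 (hb ▸ hφb.1)
  exact abs_le.2 ⟨by linarith [neg_abs_le b, le_max_right |a| |b|],
    by linarith [le_abs_self a, le_max_left |a| |b|]⟩

lemma IsC1Periodic.abs_sub_le {T D : ℝ} {u u' : ℝ → ℝ} (hu : IsC1Periodic T u u')
    (hD : ∀ t ∈ Icc 0 T, |u' t| ≤ D) {t t' : ℝ} (ht : t ∈ Icc 0 T) (ht' : t' ∈ Icc 0 T) :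
    |u t - u t'| ≤ D * |t - t'| :=
  (convex_Icc (0 : ℝ) T).norm_image_sub_le_of_norm_hasDerivWithin_le hu.1 hD ht' ht

/-- A solution above a strict lower solution cannot touch it. -/
lemma le_of_touch_lower {T : ℝ} (hT : 0 < T) {φ F : ℝ → ℝ} (hφ : StrictMono φ)
    {h : ℝ → ℝ → ℝ} (hA : CondA0 T h) {α α' u u' : ℝ → ℝ} {s₁ σ : ℝ}
    (hα : IsC1Periodic T α α') (hαi : IntegrableOn (fun t => h t (α t)) (Icc 0 T))
    (hlow : ∀ t₀ ∈ Icc 0 T, ∀ t ∈ Icc t₀ T,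
      s₁ * (t - t₀) - (∫ τ in t₀..t, h τ (α τ)) ≤ φ (α' t) + F (α t) - (φ (α' t₀) + F (α t₀)))
    (hF : ∀ t ∈ Icc 0 T, DifferentiableAt ℝ F (α t))
    (hu : IsIntegratedSol T φ F h σ u u') (hui : IntegrableOn (fun t => h t (u t)) (Icc 0 T))
    (hle : ∀ t ∈ Icc 0 T, α t ≤ u t) (htouch : ∃ t ∈ Icc 0 T, u t = α t) : s₁ ≤ σ := by
  by_contra! hlt
  have h0 : (0 : ℝ) ∈ Icc 0 T := ⟨le_rfl, hT.le⟩
  have hTT : T ∈ Icc 0 T := ⟨hT.le, le_rfl⟩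
  obtain ⟨t₀, ht₀, ht₀T, ht₀e⟩ : ∃ t₀, 0 ≤ t₀ ∧ t₀ < T ∧ u t₀ = α t₀ := by
    obtain ⟨t, ht, hte⟩ := htouch
    rcases eq_or_lt_of_le ht.2 with h | h
    · refine ⟨0, le_rfl, hT, ?_⟩
      rw [hu.1.2.2.1, hα.2.2.1, ← h, hte]
    · exact ⟨t, ht.1, h, hte⟩
  have ht₀m : t₀ ∈ Icc 0 T := ⟨ht₀, ht₀T.le⟩
  have hv : ∀ t ∈ Icc 0 T, HasDerivWithinAt (fun t => u t - α t) (u' t - α' t) (Icc 0 T) t :=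
    fun t ht => (hu.1.1 t ht).sub (hα.1 t ht)
  have hvmin : ∀ τ ∈ Icc 0 T, u t₀ - α t₀ ≤ u τ - α τ := by
    intro τ hτ
    rw [ht₀e, sub_self]
    exact sub_nonneg.2 (hle τ hτ)
  have hd0 : u' t₀ = α' t₀ := by
    have h1 : 0 ≤ u' t₀ - α' t₀ := deriv_nonneg_of_min_right ht₀ ht₀T (hv t₀ ht₀m) hvmin
    have h2 : u' t₀ - α' t₀ ≤ 0 := by
      rcases eq_or_lt_of_le ht₀ with h | h
      · have h3 := deriv_nonpos_of_min_left hT le_rfl (hv T hTT) (fun τ hτ => by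
          have := hvmin τ hτ
          rwa [← h, hu.1.2.2.1, hα.2.2.1] at this)
        rw [← hu.1.2.2.2, ← hα.2.2.2] at h3
        rwa [← h]
      · exact deriv_nonpos_of_min_left h ht₀T.le (hv t₀ ht₀m) hvmin
    linarith
  set ε := (s₁ - σ) / 4 with hε
  have hε0 : 0 < ε := by linarith
  obtain ⟨δ, hδ, hδae⟩ := hA t₀ ht₀m (α t₀) ε hε0
  -- behaviour of the damping terms
  have hFd : HasDerivWithinAt (fun t => F (u t) - F (α t)) 0 (Icc 0 T) t₀ := by
    have hFα := (hF t₀ ht₀m).hasDerivAt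
    have h1 := HasDerivAt.comp_hasDerivWithinAt t₀ (ht₀e.symm ▸ hFα) (hu.1.1 t₀ ht₀m)
    have h2 := hFα.comp_hasDerivWithinAt t₀ (hα.1 t₀ ht₀m)
    have h3 := h1.sub h2
    rw [hd0, ht₀e, sub_self] at h3
    exact h3
  have hFo : ∀ᶠ t in nhdsWithin t₀ (Icc 0 T), |F (u t) - F (α t)| ≤ ε * |t - t₀| := by
    have h1 := (hasDerivWithinAt_iff_isLittleO.1 hFd).def hε0
    filter_upwards [h1] with t ht
    simpa [ht₀e] using ht
  have hun : ∀ᶠ t in nhdsWithin t₀ (Icc 0 T), |u t - α t₀| < δ := by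
    have := (hu.1.continuousOn t₀ ht₀m).eventually (Metric.ball_mem_nhds (u t₀) hδ)
    filter_upwards [this] with t ht
    rwa [Real.dist_eq, ht₀e] at ht
  have hαn : ∀ᶠ t in nhdsWithin t₀ (Icc 0 T), |α t - α t₀| < δ :=
    (hα.continuousOn t₀ ht₀m).eventually (Metric.ball_mem_nhds (α t₀) hδ)
  obtain ⟨δ₁, hδ₁, hnear⟩ := Metric.mem_nhdsWithin_iff.1 (hFo.and (hun.and hαn))
  set b := min T (t₀ + min δ δ₁ / 2) with hb
  have hmin0 : 0 < min δ δ₁ := lt_min hδ hδ₁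
  have hbT : b ≤ T := min_le_left _ _
  have hb0 : t₀ < b := lt_min ht₀T (by linarith)
  have hbd : ∀ t ∈ Icc t₀ b, t ∈ Icc 0 T ∧ |t - t₀| < δ ∧ t ∈ Metric.ball t₀ δ₁ := by
    intro t ht
    have h1 : t ≤ t₀ + min δ δ₁ / 2 := ht.2.trans (min_le_right _ _)
    have h2 : |t - t₀| < min δ δ₁ := by
      rw [abs_of_nonneg (sub_nonneg.2 ht.1)]; linarith
    exact ⟨⟨ht₀.trans ht.1, ht.2.trans hbT⟩, h2.trans_le (min_le_left _ _),
      h2.trans_le (min_le_right _ _)⟩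
  have hnear' : ∀ t ∈ Icc t₀ b, |F (u t) - F (α t)| ≤ ε * |t - t₀| ∧ |u t - α t₀| < δ ∧
      |α t - α t₀| < δ := fun t ht => hnear ⟨(hbd t ht).2.2, (hbd t ht).1⟩
  have hneg : ∀ t ∈ Ioo t₀ b, u' t - α' t < 0 := by
    intro t ht
    have htI : t ∈ Icc 0 T := ⟨ht₀.trans ht.1.le, ht.2.le.trans hbT⟩
    have hui' := intervalIntegrable_of_integrableOn_Icc hui ht₀m htI
    have hαi' := intervalIntegrable_of_integrableOn_Icc hαi ht₀m htI
    have hintg : (∫ τ in t₀..t, h τ (α τ)) - (∫ τ in t₀..t, h τ (u τ)) ≤ 2 * ε * (t - t₀) := by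
      rw [← intervalIntegral.integral_sub hαi' hui']
      have hae : ∀ᵐ τ, τ ∈ uIoc t₀ t → ‖h τ (α τ) - h τ (u τ)‖ ≤ 2 * ε := by
        have := (ae_restrict_iff' measurableSet_Icc).1 hδae
        filter_upwards [this] with τ hτ hτm
        rw [uIoc_of_le ht.1.le] at hτm
        have hτb : τ ∈ Icc t₀ b := ⟨hτm.1.le, hτm.2.trans ht.2.le⟩
        have h1 := hτ (hbd τ hτb).1 (hbd τ hτb).2.1
        have h2 := abs_lt.1 (h1 _ (hnear' τ hτb).2.1)
        have h3 := abs_lt.1 (h1 _ (hnear' τ hτb).2.2)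
        exact abs_le.2 ⟨by linarith, by linarith⟩
      have := intervalIntegral.norm_integral_le_of_norm_le_const_ae hae
      rw [abs_of_pos (sub_pos.2 ht.1)] at this
      exact (le_abs_self _).trans this
    have hueq : φ (u' t) + F (u t) - (φ (u' t₀) + F (u t₀)) =
        σ * (t - t₀) - ∫ τ in t₀..t, h τ (u τ) := by
      rw [hu.2 t htI, hu.2 t₀ ht₀m, ← intervalIntegral.integral_interval_sub_left
        (intervalIntegrable_of_integrableOn_Icc hui h0 htI)
        (intervalIntegrable_of_integrableOn_Icc hui h0 ht₀m)]
      ring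
    have hl := hlow t₀ ht₀m t ⟨ht.1.le, htI.2⟩
    have hFb := abs_le.1 (hnear' t ⟨ht.1.le, ht.2.le⟩).1
    rw [abs_of_pos (sub_pos.2 ht.1)] at hFb
    have hpos : 0 < ε * (t - t₀) := mul_pos hε0 (sub_pos.2 ht.1)
    rw [hd0, ht₀e] at hueq
    have hs : s₁ * (t - t₀) = σ * (t - t₀) + 4 * (ε * (t - t₀)) := by
      rw [hε]; ring
    exact sub_neg.2 (hφ.lt_iff_lt.1 (by linarith [hFb.1]))
  have hsub : Icc t₀ b ⊆ Icc 0 T := Icc_subset_Icc ht₀ hbT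
  have hanti : StrictAntiOn (fun t => u t - α t) (Icc t₀ b) := by
    refine strictAntiOn_of_hasDerivWithinAt_neg (f' := fun t => u' t - α' t) (convex_Icc _ _)
      (fun t ht => ((hv t (hsub ht)).mono hsub).continuousWithinAt) ?_ ?_
    · intro t ht
      exact (hv t (hsub (interior_subset ht))).mono (interior_subset.trans hsub)
    · intro t ht
      rw [interior_Icc] at ht
      exact hneg t ht
  have := hanti (left_mem_Icc.2 hb0.le) (right_mem_Icc.2 hb0.le) hb0
  linarith [hvmin b ⟨ht₀.trans hb0.le, hbT⟩]

/-- Truncation of a real number to `[-R, R]`. -/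
def truncate (R x : ℝ) : ℝ := max (-R) (min R x)

lemma continuous_truncate (R : ℝ) : Continuous (truncate R) := by
  unfold truncate
  fun_prop

lemma abs_truncate_le {R : ℝ} (hR : 0 ≤ R) (x : ℝ) : |truncate R x| ≤ R :=
  abs_le.2 ⟨le_max_left _ _, max_le (by linarith) (min_le_left _ _)⟩

lemma truncate_of_abs_le {R x : ℝ} (hx : |x| ≤ R) : truncate R x = x := by
  have := abs_le.1 hx
  rw [truncate, min_eq_right this.2, max_eq_right this.1]

lemma abs_truncate_sub_le (R x y : ℝ) : |truncate R x - truncate R y| ≤ |x - y| := by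
  unfold truncate
  refine (abs_max_sub_max_le_max _ _ _ _).trans (max_le (by simp) ?_)
  exact (abs_min_sub_min_le_max _ _ _ _).trans (max_le (by simp) le_rfl)

lemma CondA0.comp_truncate {T : ℝ} {g : ℝ → ℝ → ℝ} (hg : CondA0 T g) (R : ℝ) :
    CondA0 T fun t x => g t (truncate R x) := by
  intro t₀ ht₀ u₀ ε hε
  obtain ⟨δ, hδ, hae⟩ := hg t₀ ht₀ (truncate R u₀) ε hε
  refine ⟨δ, hδ, ?_⟩
  filter_upwards [hae] with t ht htt u hu
  exact ht htt _ ((abs_truncate_sub_le R u u₀).trans_lt hu)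

/-- Existence of a solution located relative to a strict lower solution `α`: the minimum of
`u - α` lies strictly on the side of `c`. -/
lemma exists_solution_of_strict_lower {T : ℝ} (hT : 0 < T) {φ ψ F : ℝ → ℝ}
    (hφ : StrictMono φ) (hψ : Continuous ψ) (hψm : StrictMono ψ) (hψ0 : ψ 0 = 0)
    (hφψ : ∀ x, φ (ψ x) = x) (hF : Differentiable ℝ F) {g : ℝ → ℝ → ℝ}
    (hg : Caratheodory T g) (hA0 : CondA0 T g) {γ₀ : ℝ → ℝ}
    (hγ₀ : ∀ᵐ t ∂(muT T), ∀ x, g t x ≤ γ₀ t) {s D : ℝ} (hD0 : 0 ≤ D)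
    (hD : ∀ (F : ℝ → ℝ) (h : ℝ → ℝ → ℝ) (u u' : ℝ → ℝ) (σ : ℝ), s ≤ σ →
      (∀ᵐ t ∂(muT T), ∀ x, h t x ≤ γ₀ t) → IntegrableOn (fun t => h t (u t)) (Icc 0 T) →
      IsIntegratedSol T φ F h σ u u' → ∀ t ∈ Icc 0 T, |u' t| ≤ D)
    {α α' : ℝ → ℝ} {s₁ : ℝ} (hs : s < s₁) (hα : IsC1Periodic T α α')
    (hlow : ∀ t₀ ∈ Icc 0 T, ∀ t ∈ Icc t₀ T,
      s₁ * (t - t₀) - (∫ τ in t₀..t, g τ (α τ)) ≤ φ (α' t) + F (α t) - (φ (α' t₀) + F (α t₀)))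
    {c : ℝ}
    (hmean : ∀ u u' : ℝ → ℝ, IsC1Periodic T u u' → (∀ t ∈ Icc 0 T, |u' t| ≤ D) →
      (∀ t ∈ Icc 0 T, α t + c ≤ u t) → (∃ t ∈ Icc 0 T, u t = α t + c) →
      (∫ t in (0 : ℝ)..T, g t (u t)) < s * T) :
    ∃ (u u' : ℝ → ℝ) (r : ℝ), IsIntegratedSol T φ F g s u u' ∧ 0 < r ∧
      (∀ t ∈ Icc 0 T, α t + r * c ≤ u t) ∧ ∃ t ∈ Icc 0 T, u t = α t + r * c := by
  obtain ⟨A, hA⟩ : ∃ A, ∀ t ∈ Icc 0 T, |α t| ≤ A :=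
    isCompact_Icc.exists_bound_of_continuousOn hα.continuousOn
  have hApos : 0 ≤ A := (abs_nonneg _).trans (hA 0 ⟨le_rfl, hT.le⟩)
  set R := A + |c| + D * T + 1 with hR
  have hDT : 0 ≤ D * T := by positivity
  have hc0 := abs_nonneg c
  have hR0 : 0 < R := by positivity
  obtain ⟨γ, hγ, hγb⟩ := hg.2.2 R hR0
  obtain ⟨M, hM⟩ : ∃ M, ∀ x ∈ Icc (-R) R, |F x| ≤ M :=
    isCompact_Icc.exists_bound_of_continuousOn hF.continuous.continuousOn
  set h : ℝ → ℝ → ℝ := fun t x => g t (truncate R x) with hh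
  set FR : ℝ → ℝ := fun x => F (truncate R x) with hFR
  have hhc : ∀ᵐ t ∂(muT T), Continuous fun x => h t x := by
    filter_upwards [hg.2.1] with t ht
    exact ht.comp (continuous_truncate R)
  have hhm : ∀ x : ℝ, Measurable fun t => h t x := fun x => hg.1 _
  have hhb : ∀ᵐ t ∂(muT T), ∀ x, |h t x| ≤ γ t := by
    filter_upwards [hγb] with t ht x
    exact ht _ (abs_truncate_le hR0.le x)
  have hhγ₀ : ∀ᵐ t ∂(muT T), ∀ x, h t x ≤ γ₀ t := by
    filter_upwards [hγ₀] with t ht x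
    exact ht _
  have hFRc : Continuous FR := hF.continuous.comp (continuous_truncate R)
  obtain ⟨u, κ, σ, r, huc, hr0, hr1, hueq, huT, huσ, huα, htouch, hσlt, hσgt⟩ :=
    exists_truncated_solution hT hψ hψm hψ0 hFRc
      (fun x => hM _ (abs_le.1 (abs_truncate_le hR0.le x)))
      hhm hhc hγ hhb hα.continuousOn c s
  have hhi : ∀ v : ℝ → ℝ, ContinuousOn v (Icc 0 T) →
      IntegrableOn (fun t => h t (v t)) (Icc 0 T) := fun v hv =>
    integrableOn_superposition hhm hhc hγ hv (by filter_upwards [hhb] with t ht using ht _)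
  have hsol := isIntegratedSol_of_eq_integral hT hψ hφψ hFRc huc.continuousOn
    (hhi u huc.continuousOn) hueq huT huσ
  set u' := fun t => ψ (κ - FR (u t) + σ * t - ∫ x in (0 : ℝ)..t, h x (u x))
  have htrα : ∀ t ∈ Icc 0 T, truncate R (α t) = α t := fun t ht =>
    truncate_of_abs_le (by linarith [hA t ht])
  have htouch0 : r = 0 → s₁ ≤ σ := by
    intro hr
    simp only [hr, zero_mul, add_zero] at huα htouch
    refine le_of_touch_lower hT hφ (hA0.comp_truncate R) hα (hhi α hα.continuousOn) ?_ ?_ hsol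
      (hhi u huc.continuousOn) huα htouch
    · intro t₀ ht₀ t ht
      have ht' : t ∈ Icc 0 T := ⟨ht₀.1.trans ht.1, ht.2⟩
      have h1 := hlow t₀ ht₀ t ht
      have h2 : (∫ τ in t₀..t, h τ (α τ)) = ∫ τ in t₀..t, g τ (α τ) := by
        refine intervalIntegral.integral_congr fun τ hτ => ?_
        rw [uIcc_of_le ht.1] at hτ
        simp only [hh, htrα τ ⟨ht₀.1.trans hτ.1, hτ.2.trans ht.2⟩]
      simp only [hFR, htrα t ht', htrα t₀ ht₀]
      rw [h2]
      exact h1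
    · intro t ht
      refine (hF (α t)).congr_of_eventuallyEq ?_
      have hlt : |α t| < R := by linarith [hA t ht]
      filter_upwards [continuous_abs.continuousAt.eventually (gt_mem_nhds hlt)] with x hx
      simp only [hFR, truncate_of_abs_le (le_of_lt hx)]
  have hsσ : s ≤ σ := by
    by_contra! hlt
    linarith [htouch0 (hσlt hlt)]
  have hu'D : ∀ t ∈ Icc 0 T, |u' t| ≤ D :=
    hD FR h u u' σ hsσ hhγ₀ (hhi u huc.continuousOn) hsol
  have htru : ∀ t ∈ Icc 0 T, truncate R (u t) = u t := by
    intro t ht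
    obtain ⟨t₁, ht₁, hut₁⟩ := htouch
    have h1 := abs_le.1 (hsol.1.abs_sub_le hu'D ht ht₁)
    have h2 : |t - t₁| ≤ T := abs_le.2 ⟨by linarith [ht.1, ht₁.2], by linarith [ht.2, ht₁.1]⟩
    have h3 : D * |t - t₁| ≤ D * T := mul_le_mul_of_nonneg_left h2 hD0
    have h4 := abs_le.1 (hA t₁ ht₁)
    have h5 : |r * c| ≤ |c| := by
      rw [abs_mul, abs_of_nonneg hr0]
      exact mul_le_of_le_one_left hc0 hr1
    have h6 := abs_le.1 h5
    refine truncate_of_abs_le (abs_le.2 ⟨?_, ?_⟩)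
    · linarith [h1.1, h4.1, h6.1]
    · linarith [h1.2, h4.2, h6.2]
  have hinth : ∀ t ∈ Icc 0 T, (∫ τ in (0 : ℝ)..t, h τ (u τ)) = ∫ τ in (0 : ℝ)..t, g τ (u τ) := by
    intro t ht
    refine intervalIntegral.integral_congr fun τ hτ => ?_
    rw [uIcc_of_le ht.1] at hτ
    simp only [hh, htru τ ⟨hτ.1, hτ.2.trans ht.2⟩]
  have hsol' : IsIntegratedSol T φ F g σ u u' := by
    refine ⟨hsol.1, fun t ht => ?_⟩
    have h1 := hsol.2 t ht
    rw [hinth t ht] at h1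
    simp only [hFR, htru t ht, htru 0 ⟨le_rfl, hT.le⟩] at h1
    exact h1
  have hσs : σ = s := by
    refine le_antisymm ?_ hsσ
    by_contra! hlt
    have hr := hσgt hlt
    simp only [hr, one_mul] at huα htouch
    have h1 := hmean u u' hsol.1 hu'D huα htouch
    rw [hsol'.integral_eq hT] at h1
    nlinarith
  refine ⟨u, u', r, hσs ▸ hsol', lt_of_le_of_ne hr0 fun h0 => ?_, huα, htouch⟩
  linarith [htouch0 h0.symm]

/-- Solvability is preserved under limits of the parameter along bounded families of solutions. -/
lemma exists_solution_of_tendsto {T : ℝ} (hT : 0 < T) {φ ψ F : ℝ → ℝ} (hφ : Continuous φ)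
    (hψ : Continuous ψ) (hφψ : ∀ x, φ (ψ x) = x) (hψφ : ∀ x, ψ (φ x) = x) (hF : Continuous F)
    {g : ℝ → ℝ → ℝ} (hg : Caratheodory T g) {s : ℕ → ℝ} {s₀ : ℝ}
    (hs : Tendsto s atTop (nhds s₀)) {u u' : ℕ → ℝ → ℝ}
    (hu : ∀ n, IsIntegratedSol T φ F g (s n) (u n) (u' n)) {R D : ℝ}
    (hR : ∀ n, ∀ t ∈ Icc 0 T, |u n t| ≤ R) (hD : ∀ n, ∀ t ∈ Icc 0 T, |u' n t| ≤ D) :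
    ∃ v v', IsIntegratedSol T φ F g s₀ v v' := by
  have h0 : (0 : ℝ) ∈ Icc 0 T := ⟨le_rfl, hT.le⟩
  have hTT : T ∈ Icc 0 T := ⟨hT.le, le_rfl⟩
  have hR0 : 0 ≤ R := (abs_nonneg _).trans (hR 0 0 h0)
  have hD0 : 0 ≤ D := (abs_nonneg _).trans (hD 0 0 h0)
  obtain ⟨γ, hγ, hγb⟩ := hg.2.2 (R + 1) (by positivity)
  set h : ℝ → ℝ → ℝ := fun t x => g t (truncate (R + 1) x) with hh
  have hhc : ∀ᵐ t ∂(muT T), Continuous fun x => h t x := by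
    filter_upwards [hg.2.1] with t ht
    exact ht.comp (continuous_truncate _)
  have hhm : ∀ x : ℝ, Measurable fun t => h t x := fun x => hg.1 _
  have hhb : ∀ᵐ t ∂(muT T), ∀ x, |h t x| ≤ γ t := by
    filter_upwards [hγb] with t ht x
    exact ht _ (abs_truncate_le (by positivity) x)
  have htrunc : ∀ v : ℝ → ℝ, (∀ t ∈ Icc 0 T, |v t| ≤ R) → ∀ t ∈ Icc 0 T,
      (∫ τ in (0 : ℝ)..t, h τ (v τ)) = ∫ τ in (0 : ℝ)..t, g τ (v τ) := by
    intro v hv t ht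
    refine intervalIntegral.integral_congr fun τ hτ => ?_
    rw [uIcc_of_le ht.1] at hτ
    have hle : |v τ| ≤ R + 1 := (hv τ ⟨hτ.1, hτ.2.trans ht.2⟩).trans (by linarith)
    simp only [hh, truncate_of_abs_le hle]
  -- the solutions as elements of a compact set
  let y : ℕ → C(Icc (0 : ℝ) T, ℝ) := fun n =>
    ⟨(Icc 0 T).domRestrict (u n), (hu n).1.continuousOn.domRestrict⟩
  let κ : ℕ → ℝ := fun n => φ (u' n 0) + F (u n 0)
  obtain ⟨Mφ, hMφ⟩ : ∃ M, ∀ x ∈ Icc (-D) D, |φ x| ≤ M :=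
    isCompact_Icc.exists_bound_of_continuousOn hφ.continuousOn
  obtain ⟨MF, hMF⟩ : ∃ M, ∀ x ∈ Icc (-R) R, |F x| ≤ M :=
    isCompact_Icc.exists_bound_of_continuousOn hF.continuousOn
  have hK : ∀ n, (y n, κ n) ∈
      {y : C(Icc (0 : ℝ) T, ℝ) | LipschitzWith ⟨D, hD0⟩ y ∧ ∀ t, |y t| ≤ R} ×ˢ
        Icc (-(Mφ + MF)) (Mφ + MF) := by
    intro n
    refine ⟨⟨LipschitzWith.of_dist_le_mul fun t t' => (hu n).1.abs_sub_le (hD n) t.2 t'.2,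
      fun t => hR n t t.2⟩, abs_le.1 ?_⟩
    exact (abs_add_le _ _).trans
      (add_le_add (hMφ _ (abs_le.1 (hD n 0 h0))) (hMF _ (abs_le.1 (hR n 0 h0))))
  obtain ⟨⟨z, k⟩, hz, ι, hι, hlim⟩ :=
    ((isCompact_setOf_lipschitz_bounded (a := 0) (b := T) ⟨D, hD0⟩ R).prod
      isCompact_Icc).tendsto_subseq hK
  have hzlim : Tendsto (fun n => y (ι n)) atTop (nhds z) :=
    (continuous_fst.tendsto (z, k)).comp hlim
  have hklim : Tendsto (fun n => κ (ι n)) atTop (nhds k) :=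
    (continuous_snd.tendsto (z, k)).comp hlim
  have hslim : Tendsto (fun n => s (ι n)) atTop (nhds s₀) := hs.comp hι.tendsto_atTop
  have hyext : ∀ n, ∀ t ∈ Icc 0 T, IccExtend hT.le (y n) t = u n t := by
    intro n t ht
    rw [IccExtend_of_mem _ _ ht]
    rfl
  have hinty : ∀ n, ∀ t ∈ Icc 0 T, (∫ τ in (0 : ℝ)..t, h τ (IccExtend hT.le (y n) τ)) =
      ∫ τ in (0 : ℝ)..t, g τ (u n τ) := by
    intro n t ht
    rw [← htrunc (u n) (hR n) t ht]
    refine intervalIntegral.integral_congr fun τ hτ => ?_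
    rw [uIcc_of_le ht.1] at hτ
    simp only [hyext n τ ⟨hτ.1, hτ.2.trans ht.2⟩]
  have hprof : ∀ n, ∀ t ∈ Icc 0 T, derivProfile hT.le ψ F h (y n) (κ n) (s n) t = u' n t := by
    intro n t ht
    simp only [derivProfile, projIcc_of_mem _ ht]
    rw [hyext n t ht, hinty n t ht, ← hψφ (u' n t)]
    congr 1
    have := (hu n).2 t ht
    simp only [κ]
    linarith
  have hueq : ∀ n, ∀ t : Icc (0 : ℝ) T, y n t = y n ⟨0, h0⟩ +
      ∫ τ in (0 : ℝ)..t, derivProfile hT.le ψ F h (y n) (κ n) (s n) τ := by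
    intro n t
    have h1 := (hu n).1.integral_comp (f := fun _ => 1) (F := id) continuous_const
      (fun x => hasDerivAt_id x) t.2
    have h2 : (∫ τ in (0 : ℝ)..t, derivProfile hT.le ψ F h (y n) (κ n) (s n) τ) =
        ∫ τ in (0 : ℝ)..t, 1 * u' n τ := by
      refine intervalIntegral.integral_congr fun τ hτ => ?_
      rw [uIcc_of_le t.2.1] at hτ
      simp only [hprof n τ ⟨hτ.1, hτ.2.trans t.2.2⟩, one_mul]
    rw [h2, h1]
    change u n t = u n 0 + (u n t - u n 0)
    ring
  have heval : ∀ t, Tendsto (fun n => y (ι n) t) atTop (nhds (z t)) := fun t =>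
    ((continuous_eval_const t).tendsto z).comp hzlim
  set v : ℝ → ℝ := IccExtend hT.le z with hv
  have hvz : ∀ t (ht : t ∈ Icc 0 T), v t = z ⟨t, ht⟩ := fun t ht => IccExtend_of_mem _ _ ht
  have hvR : ∀ t ∈ Icc 0 T, |v t| ≤ R := fun t ht => by
    rw [hvz t ht]
    exact hz.1.2 _
  have hvc : Continuous v := z.continuous.Icc_extend'
  have hveq : ∀ t ∈ Icc 0 T, v t = v 0 + ∫ τ in (0 : ℝ)..t,
      ψ (k - F (v τ) + s₀ * τ - ∫ x in (0 : ℝ)..τ, h x (v x)) := by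
    intro t ht
    have h1 : Tendsto (fun n => ∫ τ in (0 : ℝ)..t,
        derivProfile hT.le ψ F h (y (ι n)) (κ (ι n)) (s (ι n)) τ) atTop
        (nhds (∫ τ in (0 : ℝ)..t, derivProfile hT.le ψ F h z k s₀ τ)) :=
      ((continuous_integral_derivProfile (hT := hT.le) hψ hF hhm hhc hγ hhb).tendsto
        ((z, k, s₀), t)).comp ((hzlim.prodMk_nhds (hklim.prodMk_nhds hslim)).prodMk_nhds
          tendsto_const_nhds)
    have h2 := tendsto_nhds_unique (heval ⟨t, ht⟩)
      (((heval ⟨0, h0⟩).add h1).congr fun n => (hueq (ι n) ⟨t, ht⟩).symm)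
    rw [hvz t ht, hvz 0 h0, h2]
    congr 1
    refine intervalIntegral.integral_congr fun τ hτ => ?_
    rw [uIcc_of_le ht.1] at hτ
    simp only [derivProfile, projIcc_of_mem _ (show τ ∈ Icc 0 T from ⟨hτ.1, hτ.2.trans ht.2⟩)]
    rfl
  have hvT : v T = v 0 := by
    rw [hvz T hTT, hvz 0 h0]
    refine tendsto_nhds_unique (heval ⟨T, hTT⟩) ((heval ⟨0, h0⟩).congr fun n => ?_)
    exact (hu (ι n)).1.2.2.1
  have hvσ : (∫ x in (0 : ℝ)..T, h x (v x)) = s₀ * T := by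
    have h1 : Tendsto (fun n => ∫ x in (0 : ℝ)..T, h x (IccExtend hT.le (y (ι n)) x)) atTop
        (nhds (∫ x in (0 : ℝ)..T, h x (v x))) :=
      ((continuous_integral_superposition hT.le hhm hhc hγ hhb).tendsto (z, ⟨T, hTT⟩)).comp
        (hzlim.prodMk_nhds tendsto_const_nhds)
    refine tendsto_nhds_unique h1 ((hslim.mul_const T).congr fun n => ?_)
    rw [hinty _ T hTT, (hu (ι n)).integral_eq hT]
  have hsol := isIntegratedSol_of_eq_integral hT hψ hφψ hF hvc.continuousOn
    (integrableOn_superposition hhm hhc hγ hvc.continuousOn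
      (by filter_upwards [hhb] with t ht using ht _)) hveq hvT hvσ
  refine ⟨v, _, hsol.1, fun t ht => ?_⟩
  rw [← htrunc v hvR t ht]
  exact hsol.2 t ht

lemma IsIntegratedSol.lower {T : ℝ} {φ F : ℝ → ℝ} {g : ℝ → ℝ → ℝ} {s : ℝ} {u u' : ℝ → ℝ}
    (hu : IsIntegratedSol T φ F g s u u') (hintg : IntegrableOn (fun t => g t (u t)) (Icc 0 T)) :
    ∀ t₀ ∈ Icc 0 T, ∀ t ∈ Icc t₀ T,
      s * (t - t₀) - (∫ τ in t₀..t, g τ (u τ)) ≤ φ (u' t) + F (u t) - (φ (u' t₀) + F (u t₀)) := by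
  intro t₀ ht₀ t ht
  have h0 : (0 : ℝ) ∈ Icc 0 T := ⟨le_rfl, ht₀.1.trans ht₀.2⟩
  have htI : t ∈ Icc 0 T := ⟨ht₀.1.trans ht.1, ht.2⟩
  rw [hu.2 t htI, hu.2 t₀ ht₀, ← intervalIntegral.integral_interval_sub_left
    (intervalIntegrable_of_integrableOn_Icc hintg h0 htI)
    (intervalIntegrable_of_integrableOn_Icc hintg h0 ht₀)]
  exact le_of_eq (by ring)

lemma exists_HII4_lt {T : ℝ} {g : ℝ → ℝ → ℝ} {g₀ s : ℝ} (h : nuStar T g g₀ < (s : EReal)) :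
    ∃ ν, HII4 T g g₀ ν ∧ ν < s := by
  obtain ⟨x, ⟨ν, rfl, hν⟩, hlt⟩ := sInf_lt_iff.1 h
  exact ⟨ν, hν, EReal.coe_lt_coe_iff.1 hlt⟩

lemma nuStar_le {T : ℝ} {g : ℝ → ℝ → ℝ} {g₀ ν : ℝ} (h : HII4 T g g₀ ν) :
    nuStar T g g₀ ≤ (ν : EReal) := sInf_le ⟨ν, rfl, h⟩

lemma exists_HII3_HII4_lt {T : ℝ} {g : ℝ → ℝ → ℝ} {g₀ s : ℝ}
    (h : nuStarStar T g g₀ < (s : EReal)) :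
    (∃ ν, HII3 T g g₀ ν ∧ ν < s) ∧ nuStar T g g₀ < (s : EReal) := by
  obtain ⟨x, ⟨ν, rfl, hν, hle⟩, hlt⟩ := sInf_lt_iff.1 h
  exact ⟨⟨ν, hν, EReal.coe_lt_coe_iff.1 hlt⟩, hle.trans_lt hlt⟩

lemma integral_lt_of_mean_lt {T ν s : ℝ} (hT : 0 < T) (hν : ν ≤ s) {k : ℝ → ℝ}
    (h : (1 / T) * (∫ t in Icc (0 : ℝ) T, k t) < ν) : (∫ t in (0 : ℝ)..T, k t) < s * T := by
  rw [intervalIntegral.integral_of_le hT.le, ← integral_Icc_eq_integral_Ioc]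
  rw [one_div, inv_mul_lt_iff₀ hT] at h
  nlinarith

/-- Dual Ambrosetti–Prodi alternative under `(H₀)`, `(Hᴵᴵ₁)`, `(Hᴵᴵ₂)`, `(Hᴵᴵ₄)`
(and `(Hᴵᴵ₃)`). -/
theorem statement9
    (T : ℝ) (hT : 0 < T)
    (φ f : ℝ → ℝ)
    (hφmono : StrictMono φ) (hφcont : Continuous φ)
    (hφsurj : Function.Surjective φ) (hφ0 : φ 0 = 0)
    (hf : Continuous f)
    (g : ℝ → ℝ → ℝ) (hCar : Caratheodory T g)
    (hH0 : CondA0 T g)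
    (hH1 : ∃ γ₀ : ℝ → ℝ, IntegrableOn γ₀ (Icc (0:ℝ) T) ∧
      (∀ᵐ t ∂(muT T), 0 ≤ γ₀ t) ∧ ∀ᵐ t ∂(muT T), ∀ u : ℝ, g t u ≤ γ₀ t)
    (u₀ g₀ : ℝ) (hH2 : ∀ᵐ t ∂(muT T), g₀ ≤ g t u₀)
    (hH4 : ∃ ν : ℝ, HII4 T g g₀ ν) :
    ∃ s₀ : ℝ, nuStar T g g₀ < (s₀ : EReal) ∧
      (∀ s : ℝ, nuStar T g g₀ < (s : EReal) → s < s₀ →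
        ∃ u : ℝ → ℝ, IsSolEs T φ f g s u) ∧
      (∀ s : ℝ, s₀ < s → ¬∃ u : ℝ → ℝ, IsSolEs T φ f g s u) ∧
      ((∃ ν : ℝ, HII3 T g g₀ ν) →
        (∃ u : ℝ → ℝ, IsSolEs T φ f g s₀ u) ∧
        ∀ s : ℝ, nuStarStar T g g₀ < (s : EReal) → s < s₀ →
          ∃ u₁ u₂ : ℝ → ℝ, IsSolEs T φ f g s u₁ ∧ IsSolEs T φ f g s u₂ ∧
            ∃ t ∈ Icc (0:ℝ) T, u₁ t ≠ u₂ t) := by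
  obtain ⟨γ₀, hγ₀i, hγ₀pos, hγ₀⟩ := hH1
  let e := hφmono.orderIsoOfSurjective φ hφsurj
  set ψ : ℝ → ℝ := fun x => e.symm x
  have hψc : Continuous ψ := e.symm.continuous
  have hψm : StrictMono ψ := e.symm.strictMono
  have hφψ : ∀ x, φ (ψ x) = x := fun x => e.apply_symm_apply x
  have hψφ : ∀ x, ψ (φ x) = x := fun x => e.symm_apply_apply x
  have hψ0 : ψ 0 = 0 := by rw [← hφ0, hψφ, hφ0]
  obtain ⟨F, hF⟩ : ∃ F : ℝ → ℝ, ∀ x, HasDerivAt F (f x) x :=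
    ⟨fun x => ∫ y in (0 : ℝ)..x, f y, fun x => (hf.integral_hasStrictDerivAt 0 x).hasDerivAt⟩
  have hFd : Differentiable ℝ F := fun x => (hF x).differentiableAt
  have h0 : (0 : ℝ) ∈ Icc 0 T := ⟨le_rfl, hT.le⟩
  -- a strict lower solution and the mean condition at `+∞` give a solution above it
  have habove : ∀ s s₁ ν : ℝ, HII4 T g g₀ ν → ν < s → s < s₁ → ∀ α α' : ℝ → ℝ,
      IsC1Periodic T α α' →
      (∀ t₀ ∈ Icc 0 T, ∀ t ∈ Icc t₀ T, s₁ * (t - t₀) - (∫ τ in t₀..t, g τ (α τ)) ≤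
        φ (α' t) + F (α t) - (φ (α' t₀) + F (α t₀))) →
      ∃ u u', IsIntegratedSol T φ F g s u u' ∧ ∀ t ∈ Icc 0 T, α t < u t := by
    rintro s s₁ ν ⟨-, d, hd, hmean⟩ hνs hs α α' hα hlow
    obtain ⟨D, hD0, hD⟩ := exists_deriv_bound hT hφmono hφsurj hφ0 hγ₀i hγ₀pos s
    obtain ⟨A, hA⟩ : ∃ A, ∀ t ∈ Icc 0 T, |α t| ≤ A :=
      isCompact_Icc.exists_bound_of_continuousOn hα.continuousOn
    have hA0 : 0 ≤ A := (abs_nonneg _).trans (hA 0 h0)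
    obtain ⟨u, u', r, hu, hr, hle, -⟩ := exists_solution_of_strict_lower hT hφmono hψc hψm hψ0 hφψ
      hFd hCar hH0 hγ₀ hD0 hD hs hα hlow (c := A + d) (fun u u' hu _ hle _ =>
        integral_lt_of_mean_lt hT hνs.le (hmean u u' hu fun t ht => by
          linarith [hle t ht, (abs_le.1 (hA t ht)).1]))
    refine ⟨u, u', hu, fun t ht => ?_⟩
    have : 0 < r * (A + d) := by positivity
    linarith [hle t ht]
  -- a strict lower solution and the mean condition at `-∞` give a solution going below it
  have hbelow : ∀ s s₁ ν : ℝ, HII3 T g g₀ ν → ν < s → s < s₁ → ∀ α α' : ℝ → ℝ,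
      IsC1Periodic T α α' →
      (∀ t₀ ∈ Icc 0 T, ∀ t ∈ Icc t₀ T, s₁ * (t - t₀) - (∫ τ in t₀..t, g τ (α τ)) ≤
        φ (α' t) + F (α t) - (φ (α' t₀) + F (α t₀))) →
      ∃ u u', IsIntegratedSol T φ F g s u u' ∧ ∃ t ∈ Icc 0 T, u t < α t := by
    rintro s s₁ ν ⟨-, d, hd, hmean⟩ hνs hs α α' hα hlow
    obtain ⟨D, hD0, hD⟩ := exists_deriv_bound hT hφmono hφsurj hφ0 hγ₀i hγ₀pos s
    obtain ⟨A, hA⟩ : ∃ A, ∀ t ∈ Icc 0 T, |α t| ≤ A :=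
      isCompact_Icc.exists_bound_of_continuousOn hα.continuousOn
    have hA0 : 0 ≤ A := (abs_nonneg _).trans (hA 0 h0)
    obtain ⟨u, u', r, hu, hr, -, t, ht, htouch⟩ := exists_solution_of_strict_lower hT hφmono hψc
      hψm hψ0 hφψ hFd hCar hH0 hγ₀ hD0 hD hs hα hlow (c := -(A + d + D * T))
      (fun u u' hu hu'D _ ⟨t₁, ht₁, htouch⟩ =>
        integral_lt_of_mean_lt hT hνs.le (hmean u u' hu fun t ht => by
          have h1 := (abs_le.1 (hu.abs_sub_le hu'D ht ht₁)).2
          have h2 : |t - t₁| ≤ T :=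
            abs_le.2 ⟨by linarith [ht.1, ht₁.2], by linarith [ht.2, ht₁.1]⟩
          have h3 := mul_le_mul_of_nonneg_left h2 hD0
          linarith [(abs_le.1 (hA t₁ ht₁)).2]))
    refine ⟨u, u', hu, t, ht, ?_⟩
    have : 0 < r * (A + d + D * T) := by positivity
    linarith
  set S : Set ℝ := {s | ∃ u, IsSolEs T φ f g s u} with hS
  have hSint : ∀ s ∈ S, ∃ u u', IsIntegratedSol T φ F g s u u' := by
    rintro s ⟨u, hu⟩
    exact ⟨u, exists_isIntegratedSol_of_isSolEs hf hF hCar hu⟩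
  have hSbdd : BddAbove S := by
    refine ⟨(∫ t in Icc 0 T, γ₀ t) / T, fun s hs => ?_⟩
    obtain ⟨u, u', hu⟩ := hSint s hs
    rw [le_div_iff₀ hT, ← hu.integral_eq hT, intervalIntegral.integral_of_le hT.le,
      ← integral_Icc_eq_integral_Ioc]
    refine integral_mono_ae (hCar.integrableOn hu.1.continuousOn) hγ₀i ?_
    filter_upwards [hγ₀] with t ht using ht _
  have hbelow_g₀ : ∀ s ν : ℝ, HII4 T g g₀ ν → ν < s → s < g₀ → s ∈ S := by
    intro s ν hν hνs hs
    have hconst : IsC1Periodic T (fun _ => u₀) (fun _ => 0) :=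
      ⟨fun t _ => hasDerivWithinAt_const t _ _, continuousOn_const, rfl, rfl⟩
    obtain ⟨u, u', hu, -⟩ := habove s g₀ ν hν hνs hs (fun _ => u₀) (fun _ => 0) hconst (by
      intro t₀ ht₀ t ht
      have htI : t ∈ Icc 0 T := ⟨ht₀.1.trans ht.1, ht.2⟩
      have hgi := intervalIntegrable_of_integrableOn_Icc
        (hCar.integrableOn hconst.continuousOn) ht₀ htI
      have h1 : (∫ _ in t₀..t, g₀) ≤ ∫ τ in t₀..t, g τ u₀ := by
        refine intervalIntegral.integral_mono_ae_restrict ht.1 intervalIntegrable_const hgi ?_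
        exact ae_restrict_of_ae_restrict_of_subset (Icc_subset_Icc ht₀.1 ht.2) hH2
      rw [intervalIntegral.integral_const, smul_eq_mul] at h1
      linarith)
    exact ⟨u, hu.isSolEs hf hF hCar⟩
  obtain ⟨ν₄, hν₄⟩ := hH4
  have hν₄g : ν₄ < g₀ := hν₄.1.trans_le (min_le_right _ _)
  have hSne : S.Nonempty := by
    obtain ⟨s, hs1, hs2⟩ := exists_between hν₄g
    exact ⟨s, hbelow_g₀ s ν₄ hν₄ hs1 hs2⟩
  have hg₀le : g₀ ≤ sSup S := by
    refine le_of_forall_lt_imp_le_of_dense fun s hs => ?_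
    obtain ⟨s', hs'1, hs'2⟩ := exists_between (max_lt hs hν₄g)
    exact (le_max_left _ _).trans (hs'1.le.trans
      (le_csSup hSbdd (hbelow_g₀ s' ν₄ hν₄ ((le_max_right _ _).trans_lt hs'1) hs'2)))
  refine ⟨sSup S, (nuStar_le hν₄).trans_lt (EReal.coe_lt_coe_iff.2 (hν₄g.trans_le hg₀le)), ?_, ?_,
    ?_⟩
  · intro s hνs hs
    obtain ⟨ν, hν, hνlt⟩ := exists_HII4_lt hνs
    obtain ⟨s₁, hs₁, hlt⟩ := exists_lt_of_lt_csSup hSne hs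
    obtain ⟨α, α', hα⟩ := hSint s₁ hs₁
    obtain ⟨u, u', hu, -⟩ := habove s s₁ ν hν hνlt hlt α α' hα.1
      (hα.lower (hCar.integrableOn hα.1.continuousOn))
    exact ⟨u, hu.isSolEs hf hF hCar⟩
  · intro s hs hex
    exact absurd (le_csSup hSbdd hex) (not_le.2 hs)
  · rintro ⟨ν₃, hν₃⟩
    refine ⟨?_, ?_⟩
    · have hν₃g : ν₃ < g₀ := hν₃.1.trans_le (min_le_right _ _)
      have hνlt : max ν₃ ν₄ < sSup S := (max_lt hν₃g hν₄g).trans_le hg₀le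
      obtain ⟨s, hsmono, hslim, hsS⟩ := exists_seq_tendsto_sSup hSne hSbdd
      obtain ⟨N, hN⟩ := (hslim.eventually (lt_mem_nhds hνlt)).exists
      choose u u' hu using fun n => hSint (s (n + N)) (hsS (n + N))
      have hslim' : Tendsto (fun n => s (n + N)) atTop (nhds (sSup S)) :=
        hslim.comp (tendsto_add_atTop_nat N)
      have hsge : ∀ n, s N ≤ s (n + N) := fun n => hsmono (Nat.le_add_left N n)
      obtain ⟨D, hD0, hD⟩ := exists_deriv_bound hT hφmono hφsurj hφ0 hγ₀i hγ₀pos (s N)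
      have hu'D : ∀ n, ∀ t ∈ Icc 0 T, |u' n t| ≤ D := fun n =>
        hD F g (u n) (u' n) _ (hsge n) hγ₀ (hCar.integrableOn (hu n).1.continuousOn) (hu n)
      obtain ⟨-, d₃, hd₃, hmean₃⟩ := hν₃
      obtain ⟨-, d₄, hd₄, hmean₄⟩ := hν₄
      have hosc : ∀ n, ∀ t ∈ Icc 0 T, ∀ t' ∈ Icc 0 T, |u n t - u n t'| ≤ D * T := by
        intro n t ht t' ht'
        refine ((hu n).1.abs_sub_le (hu'D n) ht ht').trans (mul_le_mul_of_nonneg_left ?_ hD0)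
        exact abs_le.2 ⟨by linarith [ht.1, ht'.2], by linarith [ht.2, ht'.1]⟩
      have hR : ∀ n, ∀ t ∈ Icc 0 T, |u n t| ≤ max d₃ d₄ + D * T := by
        intro n t ht
        have hge := hsge n
        have hlow : ∃ t' ∈ Icc 0 T, -d₃ < u n t' := by
          by_contra! hcon
          have := integral_lt_of_mean_lt hT
            (((le_max_left ν₃ ν₄).trans hN.le).trans hge) (hmean₃ _ _ (hu n).1 hcon)
          rw [(hu n).integral_eq hT] at this
          exact lt_irrefl _ this
        have hupp : ∃ t' ∈ Icc 0 T, u n t' < d₄ := by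
          by_contra! hcon
          have := integral_lt_of_mean_lt hT
            (((le_max_right ν₃ ν₄).trans hN.le).trans hge) (hmean₄ _ _ (hu n).1 hcon)
          rw [(hu n).integral_eq hT] at this
          exact lt_irrefl _ this
        obtain ⟨t₁, ht₁, hut₁⟩ := hlow
        obtain ⟨t₂, ht₂, hut₂⟩ := hupp
        refine abs_le.2 ⟨?_, ?_⟩
        · linarith [(abs_le.1 (hosc n t ht t₁ ht₁)).1, le_max_left d₃ d₄]
        · linarith [(abs_le.1 (hosc n t ht t₂ ht₂)).2, le_max_right d₃ d₄]
      obtain ⟨v, v', hv⟩ := exists_solution_of_tendsto hT hφcont hψc hφψ hψφ hFd.continuous hCar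
        hslim' hu hR hu'D
      exact ⟨v, hv.isSolEs hf hF hCar⟩
    · intro s hνs hs
      obtain ⟨⟨ν, hν, hνlt⟩, hνs'⟩ := exists_HII3_HII4_lt hνs
      obtain ⟨ν', hν', hνlt'⟩ := exists_HII4_lt hνs'
      obtain ⟨s₁, hs₁, hlt⟩ := exists_lt_of_lt_csSup hSne hs
      obtain ⟨α, α', hα⟩ := hSint s₁ hs₁
      have hlow := hα.lower (hCar.integrableOn hα.1.continuousOn)
      obtain ⟨u₁, u₁', hu₁, hgt⟩ := habove s s₁ ν' hν' hνlt' hlt α α' hα.1 hlow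
      obtain ⟨u₂, u₂', hu₂, t, ht, hlt₂⟩ := hbelow s s₁ ν hν hνlt hlt α α' hα.1 hlow
      exact ⟨u₁, u₂, hu₁.isSolEs hf hF hCar, hu₂.isSolEs hf hF hCar, t, ht,
        (hlt₂.trans (hgt t ht)).ne'⟩
end
end

section
/- Let T > 0 and let φ : ℝ → ℝ be an increasing homeomorphism of ℝ onto ℝ with φ(0) = 0. For every w ∈ L¹(0,T) with ∫₀ᵀ w(t) dt = 0 there exists a unique function u ∈ C¹([0,T]) such that u(0) = u(T), u'(0) = u'(T), ∫₀ᵀ u(t) dt = 0, φ∘u' is absolutely continuous on [0,T], and (φ(u'))'(t) = w(t) for a.e. t ∈ [0,T]. -/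
open MeasureTheory Set Filter

noncomputable section

/-- The parametric integral of a strictly increasing continuous function along the
translates of a continuous function is strictly increasing in the translation parameter. -/
theorem strictMono_integral_comp_add {T : ℝ} (hT : 0 < T) {ψ W : ℝ → ℝ}
    (hψ : StrictMono ψ) (hψc : Continuous ψ) (hW : Continuous W) :
    StrictMono fun c => ∫ t in (0:ℝ)..T, ψ (c + W t) := by
  intro c d hcd
  exact intervalIntegral.integral_lt_integral_of_continuousOn_of_le_of_exists_lt hT
    (by fun_prop) (by fun_prop) (fun t _ => hψ.monotone (by linarith))
    ⟨0, left_mem_Icc.2 hT.le, hψ (by linarith)⟩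

/-- Some translate `c + W` of a continuous function satisfies `∫₀ᵀ ψ (c + W) = 0`. -/
theorem exists_integral_comp_add_eq_zero {T : ℝ} (hT : 0 < T) {ψ W : ℝ → ℝ}
    (hψ : StrictMono ψ) (hψc : Continuous ψ) (hψ0 : ψ 0 = 0) (hW : Continuous W) :
    ∃ c, ∫ t in (0:ℝ)..T, ψ (c + W t) = 0 := by
  obtain ⟨M, hM⟩ := isCompact_Icc.exists_bound_of_continuousOn
    (hW.continuousOn (s := Icc (0:ℝ) T))
  have hcont : Continuous fun c => ∫ t in (0:ℝ)..T, ψ (c + W t) :=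
    intervalIntegral.continuous_parametric_intervalIntegral_of_continuous' (by fun_prop) 0 T
  refine mem_range_of_exists_le_of_exists_ge hcont ⟨-M, ?_⟩ ⟨M, ?_⟩
  · rw [← neg_nonneg, ← intervalIntegral.integral_neg]
    refine intervalIntegral.integral_nonneg hT.le fun t ht => ?_
    rw [neg_nonneg, ← hψ0]
    exact hψ.monotone (by linarith [(abs_le.1 (hM t ht)).2])
  · refine intervalIntegral.integral_nonneg hT.le fun t ht => ?_
    rw [← hψ0]
    exact hψ.monotone (by linarith [(abs_le.1 (hM t ht)).1])

/-- Two functions on `[0,T]` with the same derivative and the same integral coincide. -/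
theorem eqOn_Icc_of_hasDerivWithinAt_of_integral_eq {T : ℝ} (hT : 0 < T) {u v f : ℝ → ℝ}
    (hu : ∀ t ∈ Icc (0:ℝ) T, HasDerivWithinAt u (f t) (Icc (0:ℝ) T) t)
    (hv : ∀ t ∈ Icc (0:ℝ) T, HasDerivWithinAt v (f t) (Icc (0:ℝ) T) t)
    (h : ∫ t in Icc (0:ℝ) T, v t = ∫ t in Icc (0:ℝ) T, u t) :
    EqOn v u (Icc (0:ℝ) T) := by
  have huc : ContinuousOn u (Icc (0:ℝ) T) := fun t ht => (hu t ht).continuousWithinAt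
  have hvc : ContinuousOn v (Icc (0:ℝ) T) := fun t ht => (hv t ht).continuousWithinAt
  have hconst : ∀ t ∈ Icc (0:ℝ) T, v t = u t + (v 0 - u 0) := by
    intro t ht
    have hd : ∀ x ∈ Icc (0:ℝ) T, HasDerivWithinAt (v - u) 0 (Icc (0:ℝ) T) x := fun x hx => by
      simpa using (hv x hx).sub (hu x hx)
    have := (convex_Icc (0:ℝ) T).is_const_of_fderivWithin_eq_zero (𝕜 := ℝ)
      (fun x hx => (hd x hx).differentiableWithinAt)
      (fun x hx => by
        have := (hd x hx).hasFDerivWithinAt.fderivWithin (uniqueDiffOn_Icc hT x hx)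
        simpa using this) (left_mem_Icc.2 hT.le) ht
    simp only [Pi.sub_apply] at this
    linarith
  have hint : ∫ t in Icc (0:ℝ) T, v t = (∫ t in Icc (0:ℝ) T, u t) + T * (v 0 - u 0) := by
    rw [setIntegral_congr_fun measurableSet_Icc hconst,
      integral_add huc.integrableOn_Icc (continuousOn_const.integrableOn_Icc)]
    simp [hT.le]
  have h0 : v 0 - u 0 = 0 := by
    have : T * (v 0 - u 0) = 0 := by linarith
    exact (mul_eq_zero.1 this).resolve_left hT.ne'
  intro t ht
  rw [hconst t ht, h0, add_zero]

/-- For every `w ∈ L¹(0,T)` with zero mean there is a unique (up to values outside the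
description, i.e. unique on `[0,T]`) `C¹` function `u` with `u(0)=u(T)`, `u'(0)=u'(T)`,
`∫₀ᵀ u = 0`, `φ∘u'` absolutely continuous on `[0,T]` and `(φ(u'))' = w` a.e. -/
theorem statement10
    (T : ℝ) (hT : 0 < T)
    (φ : ℝ → ℝ)
    (hφmono : StrictMono φ) (hφcont : Continuous φ)
    (hφsurj : Function.Surjective φ) (hφ0 : φ 0 = 0)
    (w : ℝ → ℝ) (hw : IntegrableOn w (Icc (0:ℝ) T))
    (hw0 : ∫ t in Icc (0:ℝ) T, w t = 0) :
    ∃ u u' : ℝ → ℝ,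
      (IsC1Periodic T u u' ∧ (∫ t in Icc (0:ℝ) T, u t) = 0 ∧
        ∀ t ∈ Icc (0:ℝ) T, φ (u' t) = φ (u' 0) + ∫ τ in (0:ℝ)..t, w τ) ∧
      ∀ v v' : ℝ → ℝ,
        (IsC1Periodic T v v' ∧ (∫ t in Icc (0:ℝ) T, v t) = 0 ∧
          ∀ t ∈ Icc (0:ℝ) T, φ (v' t) = φ (v' 0) + ∫ τ in (0:ℝ)..t, w τ) →
        ∀ t ∈ Icc (0:ℝ) T, v t = u t := by
  let e : ℝ ≃o ℝ := hφmono.orderIsoOfSurjective φ hφsurj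
  have hφe : ∀ x, φ (e.symm x) = x := e.apply_symm_apply
  have heφ : ∀ x, e.symm (φ x) = x := e.symm_apply_apply
  have hψ : StrictMono e.symm := e.symm.strictMono
  have hψc : Continuous e.symm := e.symm.continuous
  have hψ0 : e.symm 0 = 0 := by simpa [hφ0] using heφ 0
  let W : ℝ → ℝ := fun t => ∫ τ in (0:ℝ)..t, (Icc (0:ℝ) T).indicator w τ
  have hW : Continuous W := intervalIntegral.continuous_primitive
    (fun _ _ => (hw.integrable_indicator measurableSet_Icc).intervalIntegrable) 0
  have hWw : ∀ t ∈ Icc (0:ℝ) T, W t = ∫ τ in (0:ℝ)..t, w τ := fun t ht => by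
    refine intervalIntegral.integral_congr fun τ hτ => ?_
    rw [uIcc_of_le ht.1] at hτ
    exact indicator_of_mem (Icc_subset_Icc_right ht.2 hτ) w
  have hW0 : W 0 = 0 := intervalIntegral.integral_same
  have hWT : W T = 0 := by
    rw [hWw T (right_mem_Icc.2 hT.le), intervalIntegral.integral_of_le hT.le,
      ← integral_Icc_eq_integral_Ioc, hw0]
  obtain ⟨c, hc⟩ := exists_integral_comp_add_eq_zero hT hψ hψc hψ0 hW
  let u' : ℝ → ℝ := fun t => e.symm (c + W t)
  have hu'c : Continuous u' := hψc.comp (continuous_const.add hW)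
  let p : ℝ → ℝ := fun t => ∫ τ in (0:ℝ)..t, u' τ
  let m : ℝ := (∫ t in Icc (0:ℝ) T, p t) / T
  have hp : ∀ t, HasDerivAt p (u' t) t := fun t => hu'c.integral_hasStrictDerivAt 0 t |>.hasDerivAt
  have hpc : Continuous p := continuous_iff_continuousAt.2 fun t => (hp t).continuousAt
  have hu : ∀ t ∈ Icc (0:ℝ) T,
      HasDerivWithinAt (fun s => p s - m) (u' t) (Icc (0:ℝ) T) t :=
    fun t _ => ((hp t).sub_const m).hasDerivWithinAt
  have hmean : ∫ t in Icc (0:ℝ) T, (p t - m) = 0 := by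
    rw [integral_sub hpc.continuousOn.integrableOn_Icc continuousOn_const.integrableOn_Icc]
    simp [hT.le, m, mul_div_cancel₀ _ hT.ne']
  have hu'φ : ∀ t, φ (u' t) = c + W t := fun t => hφe _
  refine ⟨fun t => p t - m, u', ⟨⟨hu, hu'c.continuousOn, ?_, ?_⟩, hmean, ?_⟩, ?_⟩
  · have h0 : p 0 = 0 := intervalIntegral.integral_same
    have hpT : p T = 0 := hc
    simp only [h0, hpT]
  · simp only [u', hW0, hWT]
  · intro t ht
    rw [hu'φ, hu'φ, hW0, hWw t ht, add_zero]
  · rintro v v' ⟨⟨hv, hv'c, hvT, -⟩, hv0, hvφ⟩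
    have hv' : ∀ t ∈ Icc (0:ℝ) T, v' t = e.symm (φ (v' 0) + W t) := fun t ht => by
      rw [hWw t ht, ← hvφ t ht, heφ]
    have hint : ∫ t in (0:ℝ)..T, v' t = 0 := by
      rw [intervalIntegral.integral_eq_sub_of_hasDeriv_right_of_le hT.le
        (fun t ht => (hv t ht).continuousWithinAt)
        (fun t ht => ((hv t (Ioo_subset_Icc_self ht)).hasDerivAt
          (Icc_mem_nhds ht.1 ht.2)).hasDerivWithinAt)
        (hv'c.intervalIntegrable_of_Icc hT.le), hvT, sub_self]
    have hd : φ (v' 0) = c := by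
      refine (strictMono_integral_comp_add hT hψ hψc hW).injective
        (Eq.trans ?_ (hint.trans hc.symm))
      refine intervalIntegral.integral_congr fun t ht => ?_
      rw [uIcc_of_le hT.le] at ht
      exact (hv' t ht).symm
    refine eqOn_Icc_of_hasDerivWithinAt_of_integral_eq hT hu (fun t ht => ?_)
      (hv0.trans hmean.symm)
    have := hv t ht
    rwa [hv' t ht, hd] at this
end
end
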